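/- arXiv:2404.14291 — 2 statements merged into one kernel-verified Lean document; each statement's English description precedes it below -/
import Mathlib

section
/- Let p be an odd prime, k and ℓ positive integers, q = p^k, Q = p^ℓ, and let c = (c0,c1,c2,c3) ∈ F_{q²}⁴. Set d = gcd(k,ℓ). Then the quadrinomial map f_c is planar over F_{q²} if and only if at least one of the following holds: (1) ℓ/d is even and f_c is linear equivalent to the map x ↦ x^{Q+1} on F_{q²}; (2) kℓ/d² is odd and f_c is linear equivalent to the map x ↦ x^{Q+q} on F_{q²}; (3) k/d is odd and there exists a non-square ε ∈ F_q^* such that f_c is linear equivalent to the map P2 : F_q × F_q → F_q × F_q given by P2(x,y) = (x^Q·y, x^{Q+1} + ε·y^{Q+1}). -/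
/-- A function between (additive groups of) finite abelian groups is planar if every
nonzero-direction derivative hits every value exactly once. -/
def IsPlanarFn {G H : Type*} [AddGroup G] [AddGroup H] (f : G → H) : Prop :=
  ∀ a : G, a ≠ 0 → ∀ b : H, ∃! x : G, f (x + a) - f x = b

/-- Linear equivalence of functions: `f = L1 ∘ g ∘ L2` for additive bijections `L1, L2`. -/
def LinEquivFn {V V' W W' : Type*} [AddGroup V] [AddGroup V'] [AddGroup W] [AddGroup W']
    (f : V → V') (g : W → W') : Prop :=
  ∃ (L1 : W' ≃+ V') (L2 : V ≃+ W), f = L1 ∘ g ∘ L2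

section Planar

theorem LinEquivFn.symm {V V' W W' : Type*} [AddGroup V] [AddGroup V'] [AddGroup W] [AddGroup W']
    {f : V → V'} {g : W → W'} (h : LinEquivFn f g) : LinEquivFn g f := by
  obtain ⟨L1, L2, rfl⟩ := h
  exact ⟨L1.symm, L2.symm, by funext x; simp⟩

theorem LinEquivFn.trans {V V' W W' U U' : Type*} [AddGroup V] [AddGroup V'] [AddGroup W]
    [AddGroup W'] [AddGroup U] [AddGroup U'] {f : V → V'} {g : W → W'} {h : U → U'}
    (h₁ : LinEquivFn f g) (h₂ : LinEquivFn g h) : LinEquivFn f h := by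
  obtain ⟨L1, L2, rfl⟩ := h₁
  obtain ⟨M1, M2, rfl⟩ := h₂
  exact ⟨M1.trans L1, L2.trans M2, by funext x; simp⟩

theorem IsPlanarFn.of_linEquivFn {V V' W W' : Type*} [AddGroup V] [AddGroup V'] [AddGroup W]
    [AddGroup W'] {f : V → V'} {g : W → W'} (hg : IsPlanarFn g) (h : LinEquivFn f g) :
    IsPlanarFn f := by
  obtain ⟨L1, L2, rfl⟩ := h
  intro a ha b
  obtain ⟨x, hx, hu⟩ := hg (L2 a) (by simpa using ha) (L1.symm b)
  refine ⟨L2.symm x, ?_, ?_⟩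
  · have := congrArg L1 hx
    simpa using this
  · intro y hy
    have : L2 y = x := hu _ (by
      have := congrArg L1.symm hy
      simpa using this)
    simp [← this]

theorem IsPlanarFn.eq_zero_of_add {G H : Type*} [AddGroup G] [AddGroup H] {f : G → H}
    (hf : IsPlanarFn f) {a x : G} (ha : a ≠ 0) (h : f (x + a) - f x = f a - f 0) : x = 0 :=
  (hf a ha _).unique h (by simp)

theorem IsPlanarFn.eq_zero_of_apply {G H : Type*} [AddGroup G] [AddGroup H] {f : G → H}
    (hf : IsPlanarFn f) (heven : ∀ x, f (-x) = f x) {a : G} (h : f a = f 0) : a = 0 := by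
  by_contra ha
  have := hf.eq_zero_of_add (x := -a) ha (by simp [heven, h])
  exact ha (by simpa using this)

theorem isPlanarFn_of_injective {G : Type*} [AddGroup G] [Finite G] {f : G → G}
    (h : ∀ a ≠ 0, Function.Injective fun x => f (x + a) - f x) : IsPlanarFn f := fun a ha =>
  (Finite.injective_iff_bijective.mp (h a ha)).existsUnique

end Planar

section Binomial

theorem choose_modEq_div_mul_mod {p : ℕ} (hp : p.Prime) (s n k : ℕ) :
    (n.choose k : ℤ) ≡ ((n / p ^ s).choose (k / p ^ s) : ℤ) *
      ((n % p ^ s).choose (k % p ^ s) : ℤ) [ZMOD p] := by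
  have := Fact.mk hp
  have hpos : 0 < p ^ s := pow_pos hp.pos s
  have key : ∀ (n i : ℕ), i ∈ Finset.range s → n % p ^ s / p ^ i % p = n / p ^ i % p := by
    intro n i hi
    have hi : i < s := Finset.mem_range.mp hi
    obtain ⟨t, rfl⟩ : ∃ t, s = i + (t + 1) := ⟨s - i - 1, by omega⟩
    rw [pow_add, Nat.mod_mul_right_div_self, Nat.mod_mod_of_dvd _ (dvd_pow_self p (by omega))]
  have h1 := Choose.choose_modEq_choose_mul_prod_range_choose (n := n) (k := k) (p := p) s
  have h2 := Choose.choose_modEq_choose_mul_prod_range_choose (n := n % p ^ s) (k := k % p ^ s)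
    (p := p) s
  rw [Nat.div_eq_of_lt (Nat.mod_lt _ hpos), Nat.div_eq_of_lt (Nat.mod_lt _ hpos)] at h2
  rw [Finset.prod_congr rfl fun i hi => by rw [key n i hi, key k i hi]] at h2
  simp only [Nat.choose_self, Nat.cast_one, one_mul] at h2
  exact h1.trans (h2.symm.mul_left _)

theorem dvd_choose_of_mod_lt {p : ℕ} (hp : p.Prime) (s : ℕ) {n k : ℕ}
    (h : n % p ^ s < k % p ^ s) : p ∣ n.choose k := by
  have h1 := choose_modEq_div_mul_mod hp s n k
  rw [Nat.choose_eq_zero_of_lt h] at h1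
  have h2 : ((n.choose k : ℕ) : ℤ) ≡ 0 [ZMOD p] := by simpa using h1
  exact_mod_cast Int.modEq_zero_iff_dvd.mp h2

/-- Among the `a` in the residue class of `h₀ P ^ 2 g + δ` modulo `R = (P ^ 3 g - 1) / (P - 1)`,
only one has `choose (h₀ R + η) a` prime to `p`. -/
theorem dvd_choose_of_modEq {p d h₀ P g R R' η δ a : ℕ} (hp : p.Prime) (hP : P = p ^ d)
    (hP2 : P = 2 * h₀ + 1) (hh : 0 < h₀) (hg : 0 < g) (hR : R * (2 * h₀) + 1 = P ^ 3 * g)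
    (hR' : R = 1 + P + P ^ 2 * R') (hη : η ≤ 1) (hδ : δ ≤ 1)
    (ha : a ≡ h₀ * P ^ 2 * g + δ [MOD R]) (hne : a ≠ h₀ * P ^ 2 * g + δ) :
    p ∣ (h₀ * R + η).choose a := by
  have hPg : 9 ≤ P ^ 2 * g := by nlinarith
  have e1 : 2 * (h₀ * R) + 1 = 2 * (h₀ * P ^ 2 * g) + P ^ 2 * g := by
    calc 2 * (h₀ * R) + 1 = P * (P ^ 2 * g) := by
          rw [show P * (P ^ 2 * g) = P ^ 3 * g by ring, ← hR]; ring
      _ = _ := by nth_rewrite 1 [hP2]; ring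
  have hRge : P ^ 2 * g ≤ R := by
    by_contra! hlt
    nlinarith
  rcases lt_or_gt_of_ne hne with hlt | hgt
  · obtain ⟨s, hs⟩ : R ∣ h₀ * P ^ 2 * g + δ - a := (Nat.modEq_iff_dvd' hlt.le).mp ha
    have hs' : h₀ * P ^ 2 * g + δ = a + R * s := by omega
    have hs0 : 0 < s := by
      rcases Nat.eq_zero_or_pos s with rfl | h
      · simp at hs'; omega
      · exact h
    have hsh : s < h₀ := by
      by_contra! hle
      have : h₀ * R ≤ R * s := by rw [mul_comm]; exact Nat.mul_le_mul_left _ hle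
      omega
    have hb : s * (1 + P) + (1 + P) ≤ h₀ * (1 + P) := by nlinarith
    have hPsq : P ^ 2 = 2 * (h₀ * P) + P := by nth_rewrite 1 [sq]; nth_rewrite 1 [hP2]; ring
    have hb' : s * (1 + P) + (1 + P) ≤ h₀ + h₀ * P := by linarith
    have hsP : 2 ≤ s * (1 + P) := by nlinarith
    have hn : (h₀ * R + η) % P ^ 2 = h₀ + h₀ * P + η := by
      have : h₀ * R + η = h₀ + h₀ * P + η + P ^ 2 * (h₀ * R') := by rw [hR']; ring
      rw [this, Nat.add_mul_mod_self_left, Nat.mod_eq_of_lt]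
      omega
    have hm : a % P ^ 2 = P ^ 2 + δ - s * (1 + P) := by
      have hlt : P ^ 2 + δ - s * (1 + P) < P ^ 2 := by omega
      rw [← Nat.mod_eq_of_lt hlt]
      have : a + s * (1 + P) ≡ (P ^ 2 + δ - s * (1 + P)) + s * (1 + P) [MOD P ^ 2] := by
        rw [Nat.sub_add_cancel (by omega)]
        have e : a + s * (1 + P) + P ^ 2 * (R' * s) = P ^ 2 * (h₀ * g) + δ := by
          have : R * s = s * (1 + P) + P ^ 2 * (R' * s) := by rw [hR']; ring
          rw [add_assoc, ← this, ← hs']; ring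
        have := congrArg (· % P ^ 2) e
        simp only [Nat.add_mul_mod_self_left, Nat.mul_add_mod] at this
        simpa [Nat.ModEq] using this
      exact Nat.ModEq.add_right_cancel' _ this
    rw [hP, ← pow_mul] at hn hm
    refine dvd_choose_of_mod_lt hp (d * 2) ?_
    rw [hn, hm, pow_mul, ← hP]
    omega
  · obtain ⟨s, hs⟩ : R ∣ a - (h₀ * P ^ 2 * g + δ) := (Nat.modEq_iff_dvd' hgt.le).mp ha.symm
    have hs0 : 0 < s := by
      rcases Nat.eq_zero_or_pos s with rfl | h
      · simp at hs; omega
      · exact h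
    have : R ≤ R * s := Nat.le_mul_of_pos_right _ hs0
    rw [Nat.choose_eq_zero_of_lt (by omega)]
    exact dvd_zero p

theorem not_dvd_choose_top {p d h₀ P g R η δ v : ℕ} (hp : p.Prime) (hP : P = p ^ d) (hd : 0 < d)
    (hP2 : P = 2 * h₀ + 1) (hg : g = p ^ v) (hR : R * (2 * h₀) + 1 = P ^ 3 * g)
    (hη : η ≤ 1) (hδ : δ ≤ 1) : ¬ p ∣ (h₀ * R + η).choose (h₀ * P ^ 2 * g + δ) := by
  have hpP : p ∣ P ^ 2 * g := by
    rw [hP]; exact Dvd.dvd.mul_right (dvd_pow (dvd_pow_self p hd.ne') two_ne_zero) _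
  have hpow : P ^ 2 * g = p ^ (d * 2 + v) := by rw [hP, hg, pow_add, pow_mul]
  have hPg : 2 ≤ P ^ 2 * g := hp.two_le.trans
    (Nat.le_of_dvd (by rw [hpow]; exact pow_pos hp.pos _) hpP)
  have e1 : 2 * (h₀ * R) + 1 = 2 * (h₀ * P ^ 2 * g) + P ^ 2 * g := by
    calc 2 * (h₀ * R) + 1 = P * (P ^ 2 * g) := by
          rw [show P * (P ^ 2 * g) = P ^ 3 * g by ring, ← hR]; ring
      _ = _ := by nth_rewrite 1 [hP2]; ring
  obtain ⟨r, hr⟩ : ∃ r, h₀ * R + η = h₀ * P ^ 2 * g + r :=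
    Nat.exists_eq_add_of_le (by omega)
  have hr2 : 2 * r + 1 = P ^ 2 * g + 2 * η := by omega
  have hrlt : r < P ^ 2 * g := by omega
  have key := choose_modEq_div_mul_mod hp (d * 2 + v) (h₀ * R + η) (h₀ * P ^ 2 * g + δ)
  have hpos : 0 < P ^ 2 * g := by omega
  rw [← hpow, hr, mul_assoc, mul_comm h₀, Nat.mul_add_mod, Nat.mul_add_mod,
    Nat.mod_eq_of_lt hrlt, Nat.mod_eq_of_lt (show δ < P ^ 2 * g by omega),
    Nat.mul_add_div hpos, Nat.mul_add_div hpos, Nat.div_eq_of_lt hrlt,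
    Nat.div_eq_of_lt (show δ < P ^ 2 * g by omega)] at key
  rw [hr, mul_assoc, mul_comm h₀]
  intro hdvd
  have h0 : ((r.choose δ : ℕ) : ℤ) ≡ 0 [ZMOD p] := by
    have := Int.modEq_zero_iff_dvd.mpr (Int.natCast_dvd_natCast.mpr hdvd)
    simpa using key.symm.trans this
  have h1 : p ∣ r.choose δ := by exact_mod_cast Int.modEq_zero_iff_dvd.mp h0
  have hp1 : ¬ p ∣ 1 := fun h => hp.one_lt.ne' (Nat.dvd_one.mp h)
  interval_cases δ
  · exact hp1 (by simpa using h1)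
  · have h2 : p ∣ 2 * r := Dvd.dvd.mul_left (by simpa using h1) 2
    interval_cases η
    · exact hp1 ((Nat.dvd_add_right h2).mp (by rw [hr2]; simpa using hpP))
    · have : 2 * r = P ^ 2 * g + 1 := by omega
      exact hp1 ((Nat.dvd_add_right hpP).mp (this ▸ h2))

end Binomial

section PowerSums

variable {K F : Type*} [Field K] [Fintype K] [DecidableEq K] [Field F] [Algebra K F]

theorem sum_units_pow_mul_one_add_pow {p d h₀ P g R Q η δ v : ℕ} [CharP F p] (hp : p.Prime)
    (hP : P = p ^ d) (hd : 0 < d) (hP2 : P = 2 * h₀ + 1) (hg : g = p ^ v)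
    (hR : R * (2 * h₀) + 1 = P ^ 3 * g) (hη : η ≤ 1) (hδ : δ ≤ 1)
    (hK : Fintype.card K = P ^ 3 * g) (hQ : Nat.gcd (Q - 1) (P ^ 3 * g - 1) = P - 1) (θ : F) :
    ∑ y : Kˣ, algebraMap K F y ^ ((Q - 1) * ((h₀ * P ^ 2 * g + δ) * R - (h₀ * P ^ 2 * g + δ))) *
        (1 + θ * algebraMap K F y ^ (Q - 1)) ^ (h₀ * R + η) =
      -(((h₀ * R + η).choose (h₀ * P ^ 2 * g + δ) : ℕ) : F) * θ ^ (h₀ * P ^ 2 * g + δ) := by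
  set A := h₀ * P ^ 2 * g + δ with hA
  set n := h₀ * R + η with hn
  have hgpos : 0 < g := hg ▸ pow_pos hp.pos v
  have hPp : 1 < P := hP ▸ Nat.one_lt_pow hd.ne' hp.one_lt
  have hh : 0 < h₀ := by omega
  have hRpos : 0 < R := by
    rcases Nat.eq_zero_or_pos R with rfl | h
    · have : 1 < P ^ 3 * g := (Nat.one_lt_pow three_ne_zero hPp).trans_le
        (Nat.le_mul_of_pos_right _ hgpos)
      omega
    · exact h
  have hq1 : P ^ 3 * g - 1 = R * (P - 1) := by rw [← hR, hP2]; simp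
  have hPQ : P - 1 ∣ Q - 1 := hQ ▸ Nat.gcd_dvd_left _ _
  obtain ⟨R', hR'⟩ : ∃ R', R = 1 + P + P ^ 2 * R' := by
    have h1 : 2 * h₀ * R + 1 = P ^ 2 * (P * g) := by rw [mul_comm, hR]; ring
    have h2 : 2 * h₀ * (1 + P) + 1 = P ^ 2 := by rw [hP2]; ring
    have hle : 1 + P ≤ R := by
      by_contra! hlt
      have : 2 * h₀ * R < 2 * h₀ * (1 + P) := by gcongr
      have : P ^ 2 ≤ P ^ 2 * (P * g) := Nat.le_mul_of_pos_right _ (by positivity)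
      omega
    obtain ⟨t, ht⟩ := Nat.exists_eq_add_of_le hle
    have h3 : P ^ 2 ∣ 2 * h₀ * t := by
      have h4 : 2 * h₀ * t + P ^ 2 = P ^ 2 * (P * g) := by rw [← h1, ht, ← h2]; ring
      exact (Nat.dvd_add_left (dvd_refl _)).mp (h4 ▸ dvd_mul_right _ _)
    have hcop : Nat.Coprime (P ^ 2) (2 * h₀) := by
      apply Nat.Coprime.pow_left
      rw [hP2]; simp
    obtain ⟨R', rfl⟩ := hcop.dvd_of_dvd_mul_left h3
    exact ⟨R', ht⟩
  have hdvd : ∀ a, P ^ 3 * g - 1 ∣ (Q - 1) * (a + (A * R - A)) ↔ a ≡ A [MOD R] := by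
    intro a
    have hle : A ≤ A * R := Nat.le_mul_of_pos_right _ hRpos
    have hiff : a ≡ A [MOD R] ↔ R ∣ a + (A * R - A) := by
      rw [← Nat.modEq_zero_iff_dvd]
      have h0 : A + (A * R - A) ≡ 0 [MOD R] := by
        rw [Nat.add_sub_cancel' hle]; exact Nat.modEq_zero_iff_dvd.mpr (dvd_mul_left _ _)
      exact ⟨fun h => (h.add_right _).trans h0,
        fun h => Nat.ModEq.add_right_cancel' _ (h.trans h0.symm)⟩
    rw [hiff]
    obtain ⟨u, hu⟩ := hPQ
    have hP1 : 0 < P - 1 := by omega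
    have hcop : Nat.Coprime u R := by
      rw [hu, hq1, mul_comm R, Nat.gcd_mul_left] at hQ
      exact Nat.eq_of_mul_eq_mul_left hP1 (by simpa using hQ)
    rw [hq1, hu, mul_comm R, mul_assoc, Nat.mul_dvd_mul_iff_left hP1]
    exact ⟨fun h => hcop.symm.dvd_of_dvd_mul_left h, fun h => h.mul_left u⟩
  have hexp : ∀ y : Kˣ, algebraMap K F y ^ ((Q - 1) * (A * R - A)) *
      (1 + θ * algebraMap K F y ^ (Q - 1)) ^ n =
      ∑ a ∈ Finset.range (n + 1), (n.choose a : F) * θ ^ a *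
        algebraMap K F ((y : K) ^ ((Q - 1) * (a + (A * R - A)))) := by
    intro y
    rw [add_comm (1 : F), add_pow, Finset.mul_sum]
    refine Finset.sum_congr rfl fun a _ => ?_
    rw [map_pow, mul_add (Q - 1), pow_add, mul_pow, ← pow_mul]
    ring
  rw [Finset.sum_congr rfl fun y _ => hexp y, Finset.sum_comm]
  simp_rw [← Finset.mul_sum, ← map_sum, FiniteField.sum_pow_units, hK, hdvd]
  rw [Finset.sum_eq_single A]
  · simp [Nat.ModEq.refl]
  · intro a _ hne
    split_ifs with hmod
    · rw [(CharP.cast_eq_zero_iff F p _).mpr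
        (dvd_choose_of_modEq hp hP hP2 hh hgpos hR hR' hη hδ hmod hne)]
      simp
    · simp
  · intro hA'
    rw [Nat.choose_eq_zero_of_lt (by simpa using hA')]
    simp

theorem sq_eq_one_of_one_add_pow_eq {p d h₀ P g R Q η v : ℕ} [CharP F p] (hp : p.Prime)
    (hP : P = p ^ d) (hd : 0 < d) (hP2 : P = 2 * h₀ + 1) (hg : g = p ^ v)
    (hR : R * (2 * h₀) + 1 = P ^ 3 * g) (hη : η ≤ 1)
    (hK : Fintype.card K = P ^ 3 * g) (hQ : Nat.gcd (Q - 1) (P ^ 3 * g - 1) = P - 1)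
    {θ ε : F} (hθ : θ ≠ 0)
    (H : ∀ y : Kˣ, (1 + θ * algebraMap K F y ^ (Q - 1)) ^ (h₀ * R + η) =
      ε * (1 + θ⁻¹ * algebraMap K F y ^ (Q - 1)) ^ (h₀ * R + η)) : θ ^ 2 = 1 := by
  have key : ∀ δ ≤ 1, θ ^ (h₀ * P ^ 2 * g + δ) = ε * θ⁻¹ ^ (h₀ * P ^ 2 * g + δ) := by
    intro δ hδ
    have h1 := sum_units_pow_mul_one_add_pow (K := K) hp hP hd hP2 hg hR hη hδ hK hQ θ
    have h2 := sum_units_pow_mul_one_add_pow (K := K) hp hP hd hP2 hg hR hη hδ hK hQ θ⁻¹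
    have hC : (((h₀ * R + η).choose (h₀ * P ^ 2 * g + δ) : ℕ) : F) ≠ 0 := fun h =>
      not_dvd_choose_top hp hP hd hP2 hg hR hη hδ ((CharP.cast_eq_zero_iff F p _).mp h)
    simp_rw [H, mul_left_comm _ ε, ← Finset.mul_sum] at h1
    rw [h2] at h1
    apply mul_left_cancel₀ (neg_ne_zero.mpr hC)
    rw [← h1]; ring
  have h0 := key 0 zero_le_one
  have h1 := key 1 le_rfl
  rw [add_zero] at h0
  rw [pow_succ θ, pow_succ θ⁻¹, ← mul_assoc, ← h0] at h1
  have h2 := mul_left_cancel₀ (pow_ne_zero _ hθ) h1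
  rw [sq]
  nth_rewrite 2 [h2]
  exact mul_inv_cancel₀ hθ

end PowerSums

/-- Every element of a finite field of odd order becomes a square in the quadratic extension. -/
theorem exists_sq_eq_algebraMap {K F : Type*} [Field K] [Fintype K] [Field F] [Fintype F]
    [Algebra K F] (hcard : Fintype.card F = Fintype.card K ^ 2) (hK : ringChar K ≠ 2) (x : K) :
    ∃ r : F, r ^ 2 = algebraMap K F x := by
  by_cases hx : x = 0
  · exact ⟨0, by rw [hx]; simp⟩
  have hx' : algebraMap K F x ≠ 0 := (map_ne_zero _).2 hx
  have hF : ringChar F ≠ 2 := by rwa [← Algebra.ringChar_eq K F]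
  have hsq : IsSquare (algebraMap K F x) := by
    rw [FiniteField.isSquare_iff hF hx']
    obtain ⟨h, hh⟩ := Nat.odd_iff.2 (FiniteField.odd_card_of_char_ne_two hK)
    have h1 := FiniteField.pow_card_sub_one_eq_one x hx
    have h2 : Fintype.card F / 2 = 2 * h * (h + 1) := by
      rw [hcard, hh, show (2 * h + 1) ^ 2 = 1 + 2 * (2 * h * (h + 1)) by ring]
      omega
    rw [hh, Nat.add_sub_cancel] at h1
    rw [h2, pow_mul, ← map_pow, h1]; simp
  obtain ⟨r, hr⟩ := hsq
  exact ⟨r, by rw [hr, sq]⟩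

/-- For coefficients `κ ∉ {0, 1}`, the form `(y ^ Q - y) ^ 2 + 4 κ y ^ (Q + 1)` attains every
nonzero square class (up to zero values) on the nonzero elements of a finite field that is of
degree at least three over the fixed field of `y ↦ y ^ Q`. -/
theorem exists_isSquare_mul_form {p k ℓ Q : ℕ} (hp : p.Prime) (hodd : Odd p)
    (hQ : Q = p ^ ℓ) {K F : Type*} [Field K] [Fintype K] [Field F] [Fintype F]
    [Algebra K F] (hK : Fintype.card K = p ^ k) (hF : Fintype.card F = p ^ (2 * k))
    (hl : 0 < ℓ) (hm : 3 * k.gcd ℓ ≤ k) {κ e : K} (h0 : κ ≠ 0) (h1 : κ ≠ 1) (he : e ≠ 0) :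
    ∃ y : K, y ≠ 0 ∧ IsSquare (e * ((y ^ Q - y) ^ 2 + 4 * κ * y ^ (Q + 1))) := by
  classical
  by_contra! hcon
  have := Fact.mk hp
  have : CharP K p := charP_of_card_eq_prime_pow hK
  have : CharP F p := charP_of_card_eq_prime_pow hF
  have hp2 : p ≠ 2 := by rintro rfl; revert hodd; decide
  have h2K : (2 : K) ≠ 0 := Ring.two_ne_zero (by rw [ringChar.eq K p]; exact hp2)
  have h2F : (2 : F) ≠ 0 := Ring.two_ne_zero (by rw [ringChar.eq F p]; exact hp2)
  set d := k.gcd ℓ with hd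
  have hd0 : 0 < d := Nat.gcd_pos_of_pos_right _ hl
  obtain ⟨m, hkm⟩ : d ∣ k := Nat.gcd_dvd_left k ℓ
  obtain ⟨m', rfl⟩ : ∃ m', m = m' + 3 := by
    refine ⟨m - 3, ?_⟩
    have : 3 ≤ m := by
      rw [hkm, mul_comm 3] at hm
      exact Nat.le_of_mul_le_mul_left hm hd0
    omega
  obtain ⟨h₀, hP2⟩ : Odd (p ^ d) := hodd.pow
  obtain ⟨P, hP⟩ : ∃ P, P = p ^ d := ⟨_, rfl⟩
  obtain ⟨g, hg⟩ : ∃ g, g = p ^ (d * m') := ⟨_, rfl⟩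
  rw [← hP] at hP2
  have hq : p ^ k = P ^ 3 * g := by rw [hkm, hP, hg, ← pow_mul, ← pow_add]; ring_nf
  have hP0 : 0 < P := by omega
  have hg0 : 0 < g := by rw [hg]; exact pow_pos hp.pos _
  obtain ⟨R, hR⟩ : ∃ R, R * (2 * h₀) + 1 = P ^ 3 * g := by
    have h : P - 1 ∣ P ^ (m' + 3) - 1 := by simpa using Nat.sub_dvd_pow_sub_pow P 1 (m' + 3)
    obtain ⟨R, hR⟩ := h
    refine ⟨R, ?_⟩
    have h1 : P ^ (m' + 3) = P ^ 3 * g := by rw [hg, hP, ← pow_mul, ← pow_mul, ← pow_add]; ring_nf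
    rw [← h1, mul_comm R]
    have : 0 < P ^ (m' + 3) := pow_pos hP0 _
    have h2 : P - 1 = 2 * h₀ := by omega
    rw [h2] at hR
    omega
  have hgcd : Nat.gcd (Q - 1) (P ^ 3 * g - 1) = P - 1 := by
    rw [← hq, hQ, Nat.pow_sub_one_gcd_pow_sub_one, Nat.gcd_comm, ← hd, hP]
  have hcard : Fintype.card K = 2 * (h₀ * R) + 1 := by rw [hK, hq, ← hR]; ring
  obtain ⟨h, hh⟩ : ∃ h, h = h₀ * R := ⟨_, rfl⟩
  rw [← hh] at hcard
  have hQ1 : Q = (Q - 1) + 1 := by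
    have : 0 < Q := by rw [hQ]; exact pow_pos hp.pos _
    omega
  have hfer : ∀ y : K, y ≠ 0 → y ^ (2 * h) = 1 := fun y hy => by
    have := FiniteField.pow_card_sub_one_eq_one y hy
    rwa [hcard, Nat.add_sub_cancel] at this
  have hringK : ringChar K ≠ 2 := by rw [ringChar.eq K p]; exact hp2
  set T : K := 4 * κ - 2 with hT
  have key : ∀ y : K, y ≠ 0 → e ^ h * (1 + T * y ^ (Q - 1) + (y ^ (Q - 1)) ^ 2) ^ h = -1 := by
    intro y hy
    have hns := hcon y hy
    have hE : e * ((y ^ Q - y) ^ 2 + 4 * κ * y ^ (Q + 1)) =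
        y ^ 2 * (e * (1 + T * y ^ (Q - 1) + (y ^ (Q - 1)) ^ 2)) := by
      conv_lhs => rw [hQ1]
      rw [hT]; ring
    rw [hE] at hns
    have hne : y ^ 2 * (e * (1 + T * y ^ (Q - 1) + (y ^ (Q - 1)) ^ 2)) ≠ 0 := by
      intro h; rw [h] at hns; exact hns IsSquare.zero
    have hc2 : Fintype.card K / 2 = h := by omega
    have h3 := (FiniteField.pow_dichotomy hringK hne).resolve_left
      (fun h => hns ((FiniteField.isSquare_iff hringK hne).2 h))
    rw [hc2, mul_pow, mul_pow, ← pow_mul, hfer y hy, one_mul] at h3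
    exact h3
  obtain ⟨r, hr⟩ := exists_sq_eq_algebraMap (F := F) (by rw [hK, hF]; ring) hringK (T ^ 2 - 4)
  set τ : F := algebraMap K F T with hτ
  have hr' : r ^ 2 = τ ^ 2 - 4 := by rw [hr, map_sub, map_pow, map_ofNat]
  obtain ⟨θ, hθ⟩ : ∃ θ, θ = (τ + r) / 2 := ⟨_, rfl⟩
  obtain ⟨θ', hθ'⟩ : ∃ θ', θ' = (τ - r) / 2 := ⟨_, rfl⟩
  have hmul : θ * θ' = 1 := by
    rw [hθ, hθ']; field_simp; linear_combination -hr'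
  have hadd : θ + θ' = τ := by rw [hθ, hθ']; field_simp; ring
  have hθ0 : θ ≠ 0 := left_ne_zero_of_mul_eq_one hmul
  have hinv : θ⁻¹ = θ' := (eq_inv_of_mul_eq_one_right hmul).symm
  have hKq : ∀ x : K, (algebraMap K F x) ^ (2 * h + 1) = algebraMap K F x := fun x => by
    rw [← map_pow, ← hcard, FiniteField.pow_card]
  have hfrob : ∀ x y : F, (x + y) ^ (2 * h + 1) = x ^ (2 * h + 1) + y ^ (2 * h + 1) := by
    intro x y; rw [← hcard, hK]; exact add_pow_char_pow _ _ _ _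
  have hconj : θ ^ (2 * h + 1) = θ ∨ θ ^ (2 * h + 1) = θ' := by
    have h2q : (2 : F) ^ (2 * h + 1) = 2 := by simpa only [map_ofNat] using hKq 2
    have h1 : (r ^ (2 * h + 1)) ^ 2 = r ^ 2 := by
      rw [← pow_mul, mul_comm, pow_mul, hr, hKq]
    have hθq : θ ^ (2 * h + 1) = (τ + r ^ (2 * h + 1)) / 2 := by
      rw [hθ, div_pow, h2q, hfrob, hKq]
    rcases sq_eq_sq_iff_eq_or_eq_neg.1 h1 with h | h
    · left; rw [hθq, h, hθ]
    · right; rw [hθq, h, hθ', sub_eq_add_neg]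
  have heh : e ^ h ≠ 0 := pow_ne_zero _ he
  obtain ⟨ε, hε⟩ : ∃ ε : F, ε = -(algebraMap K F (e ^ h))⁻¹ := ⟨_, rfl⟩
  have heF : algebraMap K F (e ^ h) ≠ 0 := (map_ne_zero _).2 heh
  have hε0 : ε ≠ 0 := by rw [hε]; exact neg_ne_zero.2 (inv_ne_zero heF)
  have keyF : ∀ y : K, y ≠ 0 → (1 + θ * algebraMap K F y ^ (Q - 1)) ^ h *
      (1 + θ' * algebraMap K F y ^ (Q - 1)) ^ h = ε := by
    intro y hy
    have h3 := congrArg (algebraMap K F) (key y hy)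
    rw [map_mul, map_pow (algebraMap K F) (_ + _)] at h3
    simp only [map_add, map_mul, map_one, map_neg, ← hτ] at h3
    rw [← mul_pow, hε]
    have : (1 + θ * algebraMap K F y ^ (Q - 1)) * (1 + θ' * algebraMap K F y ^ (Q - 1)) =
      1 + τ * algebraMap K F (y ^ (Q - 1)) + algebraMap K F ((y ^ (Q - 1)) ^ 2) := by
      rw [← hadd]; simp only [map_pow]
      linear_combination (algebraMap K F y ^ (Q - 1)) ^ 2 * hmul
    rw [this]
    field_simp
    linear_combination h3
  have hsq : θ ^ 2 = 1 := by
    rcases hconj with hc | hc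
    · refine sq_eq_one_of_one_add_pow_eq (K := K) (η := 0) (ε := ε) (v := d * m') (Q := Q) hp hP hd0
        hP2 hg hR (by norm_num) (by rw [hK, hq]) hgcd hθ0 fun y => ?_
      rw [hinv, add_zero, ← hh]
      have hk1 := keyF y y.ne_zero
      have hθ'c : θ' ^ (2 * h + 1) = θ' := by rw [← hinv, inv_pow, hc]
      set z := algebraMap K F (y : K) ^ (Q - 1) with hz
      have hzq : z ^ (2 * h + 1) = z := by rw [hz, ← map_pow, hKq]
      have hBq : (1 + θ' * z) ^ (2 * h + 1) = 1 + θ' * z := by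
        rw [hfrob, one_pow, mul_pow, hθ'c, hzq]
      have hB0 : 1 + θ' * z ≠ 0 := by
        intro hB
        have : h ≠ 0 := by
          rintro rfl
          have := Fintype.one_lt_card (α := K)
          omega
        rw [hB, zero_pow this, mul_zero] at hk1
        exact hε0 hk1.symm
      have hB1 : (1 + θ' * z) ^ (2 * h) = 1 := by
        rw [pow_succ] at hBq
        exact mul_right_cancel₀ hB0 (by rw [hBq, one_mul])
      linear_combination (1 + θ' * z) ^ h * hk1 - (1 + θ * z) ^ h * hB1
    · refine sq_eq_one_of_one_add_pow_eq (K := K) (η := 1) (ε := ε⁻¹) (v := d * m') (Q := Q) hp hP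
        hd0 hP2 hg hR le_rfl (by rw [hK, hq]) hgcd hθ0 fun y => ?_
      rw [hinv, ← hh]
      have hk1 := keyF y y.ne_zero
      set z := algebraMap K F (y : K) ^ (Q - 1) with hz
      have hzq : z ^ (2 * h + 1) = z := by rw [hz, ← map_pow, hKq]
      have hAq : (1 + θ * z) ^ (2 * h + 1) = 1 + θ' * z := by
        rw [hfrob, one_pow, mul_pow, hc, hzq]
      rw [eq_inv_mul_iff_mul_eq₀ hε0, ← hk1]
      linear_combination (1 + θ' * z) ^ h * hAq
  have hτ2 : τ ^ 2 = 4 := by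
    have : θ = θ' := by rw [← hinv]; exact eq_inv_of_mul_eq_one_left (by rw [← sq, hsq])
    rw [← hadd, ← this]; linear_combination 4 * hsq
  have hT2 : T ^ 2 = 4 := (algebraMap K F).injective (by rw [map_pow, ← hτ, hτ2, map_ofNat])
  have : (4 * 4 : K) * (κ * (κ - 1)) = 0 := by rw [hT] at hT2; linear_combination hT2
  have h4 : (4 * 4 : K) ≠ 0 := by
    rw [show (4 * 4 : K) = 2 ^ 4 by norm_num]; exact pow_ne_zero _ h2K
  rcases mul_eq_zero.1 ((mul_eq_zero.1 this).resolve_left h4) with h | h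
  · exact h0 h
  · exact h1 (sub_eq_zero.1 h)

section Frobenius

theorem pow_pow_eq_neg_one_pow_mul {R : Type*} [CommRing R] {Q s : ℕ} (hQ : Odd Q) (hs : Odd s)
    {u : R} (h : u ^ Q = -u ^ s) (j : ℕ) : u ^ Q ^ j = (-1) ^ j * u ^ s ^ j := by
  induction j with
  | zero => simp
  | succ j ih =>
    have h1 : ((-1 : R) ^ j) ^ Q = (-1) ^ j := by rw [← pow_mul, mul_comm, pow_mul, hQ.neg_one_pow]
    rw [pow_succ Q, pow_mul, ih, mul_pow, h1, ← pow_mul, mul_comm (s ^ j), pow_mul u, h,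
      (hs.pow (n := j)).neg_pow, ← pow_mul, ← pow_succ']
    ring

theorem eq_zero_of_eq_neg_self {p : ℕ} (hodd : Odd p) {L : Type*} [Field L] [CharP L p] {u : L}
    (h : u = -u) : u = 0 := by
  have h2 : (2 : L) ≠ 0 := Ring.two_ne_zero (by
    rw [ringChar.eq L p]; rintro rfl; revert hodd; decide)
  have : 2 * u = 0 := by linear_combination h
  exact (mul_eq_zero.1 this).resolve_left h2

theorem eq_zero_of_pow_add_self {p k ℓ : ℕ} (hodd : Odd p) {L : Type*} [Field L]
    [Fintype L] [CharP L p] (hL : Fintype.card L = p ^ k) (hk : Odd (k / k.gcd ℓ)) {u : L}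
    (h : u ^ p ^ ℓ + u = 0) : u = 0 := by
  have h1 := pow_pow_eq_neg_one_pow_mul (Q := p ^ ℓ) (s := 1) hodd.pow odd_one (u := u)
    (by rw [pow_one]; linear_combination h) (k / k.gcd ℓ)
  have h2 : (p ^ ℓ) ^ (k / k.gcd ℓ) = Fintype.card L ^ (ℓ / k.gcd ℓ) := by
    rw [hL, ← pow_mul, ← pow_mul, ← Nat.mul_div_assoc _ (Nat.gcd_dvd_left _ _),
      ← Nat.mul_div_assoc _ (Nat.gcd_dvd_right _ _), mul_comm]
  rw [h2, FiniteField.pow_card_pow, hk.neg_one_pow] at h1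
  exact eq_zero_of_eq_neg_self hodd (by simpa using h1)

theorem eq_zero_of_pow_add_pow {p k ℓ : ℕ} (hodd : Odd p) {L : Type*} [Field L]
    [Fintype L] [CharP L p] (hL : Fintype.card L = p ^ (2 * k)) (hk : Odd (k / k.gcd ℓ))
    (hl : Odd (ℓ / k.gcd ℓ)) {u : L} (h : u ^ p ^ ℓ + u ^ p ^ k = 0) : u = 0 := by
  have h1 := pow_pow_eq_neg_one_pow_mul (Q := p ^ ℓ) (s := p ^ k) hodd.pow hodd.pow (u := u)
    (by linear_combination h) (k / k.gcd ℓ)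
  have h2 : (p ^ ℓ) ^ (k / k.gcd ℓ) = (p ^ k) ^ (ℓ / k.gcd ℓ) := by
    rw [← pow_mul, ← pow_mul, ← Nat.mul_div_assoc _ (Nat.gcd_dvd_left _ _),
      ← Nat.mul_div_assoc _ (Nat.gcd_dvd_right _ _), mul_comm]
  have h3 : ∀ j, Odd j → u ^ (p ^ k) ^ j = u ^ p ^ k := by
    rintro j ⟨i, rfl⟩
    rw [pow_succ, pow_mul (p ^ k), ← pow_mul p, mul_comm k, ← hL, pow_mul u,
      FiniteField.pow_card_pow]
  rw [h2, h3 _ hl, h3 _ hk, hk.neg_one_pow] at h1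
  exact pow_eq_zero_iff (pow_pos hodd.pos _).ne' |>.1
    (eq_zero_of_eq_neg_self hodd (by simpa using h1))

theorem exists_pow_eq_neg {p N d : ℕ} (hp : p.Prime) (hodd : Odd p) (hd : 0 < d)
    {L : Type*} [Field L] [Fintype L] (hL : Fintype.card L = p ^ N) (hdN : 2 * d ∣ N) :
    ∃ ω : L, ω ≠ 0 ∧ ω ^ p ^ d = -ω := by
  classical
  obtain ⟨g, hg⟩ := IsCyclic.exists_generator (α := Lˣ)
  have hord : orderOf g = p ^ N - 1 := by
    rw [orderOf_eq_card_of_forall_mem_zpowers hg, Nat.card_eq_fintype_card, Fintype.card_units, hL]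
  obtain ⟨s, hs⟩ := hdN
  obtain ⟨r, hr⟩ : Odd (p ^ d) := hodd.pow
  have hP1 : 1 < p ^ d := Nat.one_lt_pow hd.ne' hp.one_lt
  have hdvd : 2 * (p ^ d - 1) ∣ p ^ N - 1 := by
    have h1 : (p ^ (2 * d)) - 1 ∣ p ^ N - 1 := by
      simpa [hs, pow_mul] using Nat.sub_dvd_pow_sub_pow (p ^ (2 * d)) 1 s
    refine dvd_trans ⟨r + 1, ?_⟩ h1
    rw [mul_comm 2 d, pow_mul, hr, Nat.add_sub_cancel]
    have : (2 * r + 1) ^ 2 = 2 * (2 * r) * (r + 1) + 1 := by ring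
    rw [this, Nat.add_sub_cancel]
  obtain ⟨n, hn⟩ := hdvd
  have hN : 0 < p ^ N - 1 := by
    rw [← hord]; exact orderOf_pos g
  have hn0 : 0 < n := Nat.pos_of_ne_zero (by rintro rfl; omega)
  refine ⟨(g : L) ^ n, pow_ne_zero _ g.ne_zero, ?_⟩
  have h1 : ((g : L) ^ (n * (p ^ d - 1))) ^ 2 = 1 := by
    rw [← pow_mul, show n * (p ^ d - 1) * 2 = p ^ N - 1 by rw [hn]; ring, ← hord]
    rw [← Units.val_pow_eq_pow_val, pow_orderOf_eq_one, Units.val_one]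
  have h2 : (g : L) ^ (n * (p ^ d - 1)) ≠ 1 := by
    intro h
    have h3 : g ^ (n * (p ^ d - 1)) = 1 :=
      Units.ext (by rw [Units.val_pow_eq_pow_val, h, Units.val_one])
    have h4 := Nat.le_of_dvd (Nat.mul_pos hn0 (by omega)) (orderOf_dvd_of_pow_eq_one h3)
    rw [hord] at h4
    have : p ^ N - 1 = 2 * (n * (p ^ d - 1)) := by rw [hn]; ring
    omega
  have h3 := (sq_eq_one_iff.1 h1).resolve_left h2
  obtain ⟨P, hP⟩ : ∃ P, p ^ d = P + 1 := ⟨p ^ d - 1, by omega⟩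
  rw [hP, Nat.add_sub_cancel, pow_mul] at h3
  rw [hP, pow_succ, h3, neg_one_mul]

theorem sub_pow_of_add_pow {R : Type*} [CommRing R] {Q : ℕ}
    (hQ : ∀ x y : R, (x + y) ^ Q = x ^ Q + y ^ Q) (x y : R) : (x - y) ^ Q = x ^ Q - y ^ Q := by
  have := hQ (x - y) y
  rw [sub_add_cancel] at this
  exact eq_sub_of_add_eq this.symm

theorem bijective_pow_add_self {R : Type*} [CommRing R] [Finite R] {Q : ℕ}
    (hQ : ∀ x y : R, (x + y) ^ Q = x ^ Q + y ^ Q) (h0 : ∀ u : R, u ^ Q + u = 0 → u = 0) :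
    Function.Bijective fun u : R => u ^ Q + u := by
  rw [← Finite.injective_iff_bijective]
  intro x y h
  refine sub_eq_zero.1 (h0 _ ?_)
  rw [sub_pow_of_add_pow hQ]
  linear_combination h

theorem bijective_pow_of_add_pow {K : Type*} [Field K] [Finite K] {Q : ℕ} (h0 : Q ≠ 0)
    (hQ : ∀ x y : K, (x + y) ^ Q = x ^ Q + y ^ Q) : Function.Bijective fun u : K => u ^ Q := by
  rw [← Finite.injective_iff_bijective]
  intro x y h
  refine sub_eq_zero.1 ((pow_eq_zero_iff h0).1 ?_)
  rw [sub_pow_of_add_pow hQ]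
  exact sub_eq_zero.2 h

end Frobenius

section Examples

theorem isPlanarFn_pow_add {L : Type*} [Field L] [Finite L] {Q s : ℕ}
    (hQ : ∀ x y : L, (x + y) ^ Q = x ^ Q + y ^ Q) (hs : ∀ x y : L, (x + y) ^ s = x ^ s + y ^ s)
    (h0 : ∀ u : L, u ^ Q + u ^ s = 0 → u = 0) : IsPlanarFn fun x : L => x ^ (Q + s) := by
  refine isPlanarFn_of_injective fun a ha x y h => sub_eq_zero.1 ?_
  simp only [pow_add, hQ, hs] at h
  have h1 : (x - y) ^ Q * a ^ s + a ^ Q * (x - y) ^ s = 0 := by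
    rw [sub_pow_of_add_pow hQ, sub_pow_of_add_pow hs]; linear_combination h
  have h2 := h0 ((x - y) / a) (by rw [div_pow, div_pow]; field_simp; linear_combination h1)
  exact (div_eq_zero_iff.1 h2).resolve_right ha

theorem isPlanarFn_prod {K : Type*} [Field K] [Finite K] {Q : ℕ} (hodd : Odd Q)
    (hQ : ∀ x y : K, (x + y) ^ Q = x ^ Q + y ^ Q) (h0 : ∀ u : K, u ^ Q + u = 0 → u = 0)
    {ε : K} (hε0 : ε ≠ 0) (hε : ¬ ∃ z : K, z ^ 2 = ε) :
    IsPlanarFn fun xy : K × K =>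
      (xy.1 ^ Q * xy.2, xy.1 ^ (Q + 1) + ε * xy.2 ^ (Q + 1)) := by
  have hQ0 : Q ≠ 0 := hodd.pos.ne'
  refine isPlanarFn_of_injective ?_
  rintro ⟨a, b⟩ hab ⟨x, y⟩ ⟨x', y'⟩ h
  simp only [pow_succ, Prod.mk_add_mk, Prod.mk_sub_mk, Prod.mk.injEq, hQ] at h
  obtain ⟨h1, h2⟩ := h
  obtain ⟨X, rfl⟩ : ∃ X, x = x' + X := ⟨x - x', by ring⟩
  obtain ⟨Y, rfl⟩ : ∃ Y, y = y' + Y := ⟨y - y', by ring⟩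
  rw [hQ] at h1 h2
  rw [hQ] at h2
  have h3 : X ^ Q * b + a ^ Q * Y = 0 := by linear_combination h1
  have h4 : X ^ Q * a + a ^ Q * X + ε * (Y ^ Q * b + b ^ Q * Y) = 0 := by linear_combination h2
  have single : ∀ {a X : K}, a ≠ 0 → X ^ Q * a + a ^ Q * X = 0 → X = 0 := by
    intro a X ha h
    have := h0 (X / a) (by rw [div_pow]; field_simp; linear_combination h)
    exact (div_eq_zero_iff.1 this).resolve_right ha
  suffices X = 0 ∧ Y = 0 by rw [this.1, this.2, add_zero, add_zero]
  by_cases ha : a = 0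
  · have hb : b ≠ 0 := by rintro rfl; exact hab (by rw [ha]; rfl)
    subst ha
    rw [zero_pow hQ0] at h3 h4
    have hX : X = 0 := by simpa [hb, hQ0] using h3
    refine ⟨hX, single hb (mul_left_cancel₀ hε0 ?_)⟩
    rw [hX] at h4; linear_combination h4
  by_cases hb : b = 0
  · subst hb
    rw [zero_pow hQ0] at h4
    have hY : Y = 0 := by simpa [ha, hQ0] using h3
    exact ⟨single ha (by linear_combination h4), hY⟩
  obtain ⟨u, rfl⟩ : ∃ u, X = a * u := ⟨X / a, by field_simp⟩
  have hY : Y = -(u ^ Q * b) :=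
    mul_left_cancel₀ (pow_ne_zero Q ha) (by rw [mul_pow] at h3; linear_combination h3)
  by_cases hu : u = 0
  · rw [hY, hu]; simp [hQ0]
  exfalso
  have hw : u ^ Q + u ≠ 0 := fun h => hu (h0 u h)
  have h5 : a ^ (Q + 1) * (u ^ Q + u) = ε * (b ^ (Q + 1) * (u ^ Q + u) ^ Q) := by
    rw [hY, hodd.neg_pow, mul_pow, mul_pow] at h4
    rw [hQ, pow_succ, pow_succ]; linear_combination h4
  obtain ⟨r, hr⟩ := hodd
  refine hε ⟨(a / b) ^ (r + 1) / (u ^ Q + u) ^ r, ?_⟩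
  have h6 : ((a / b) ^ (r + 1) / (u ^ Q + u) ^ r) ^ 2 =
      a ^ (Q + 1) * (u ^ Q + u) / (b ^ (Q + 1) * (u ^ Q + u) ^ Q) := by
    set w := u ^ Q + u
    rw [hr, div_pow a]; field_simp; ring
  rw [h6, h5]
  field_simp

end Examples

section Forms

variable {K : Type*} [Field K] {Q : ℕ}

/-- The map `K × K → K × K` whose components are `M₀ x^Q x + M₁ x^Q y + M₂ y^Q x + M₃ y^Q y`. -/
def formMap (Q : ℕ) (a₀ a₁ a₂ a₃ b₀ b₁ b₂ b₃ : K) (z : K × K) : K × K :=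
  (a₀ * z.1 ^ Q * z.1 + a₁ * z.1 ^ Q * z.2 + a₂ * z.2 ^ Q * z.1 + a₃ * z.2 ^ Q * z.2,
    b₀ * z.1 ^ Q * z.1 + b₁ * z.1 ^ Q * z.2 + b₂ * z.2 ^ Q * z.1 + b₃ * z.2 ^ Q * z.2)

/-- The additive automorphism of `K × K` given by an invertible `2 × 2` matrix. -/
def prodAddEquiv (r s t u : K) (h : r * u - s * t ≠ 0) : K × K ≃+ K × K where
  toFun z := (r * z.1 + s * z.2, t * z.1 + u * z.2)
  invFun z := ((u * z.1 - s * z.2) / (r * u - s * t), (r * z.2 - t * z.1) / (r * u - s * t))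
  left_inv z := by
    ext
    · show (u * (r * z.1 + s * z.2) - s * (t * z.1 + u * z.2)) / (r * u - s * t) = z.1
      rw [div_eq_iff h]; ring
    · show (r * (t * z.1 + u * z.2) - t * (r * z.1 + s * z.2)) / (r * u - s * t) = z.2
      rw [div_eq_iff h]; ring
  right_inv z := by
    ext
    · show r * ((u * z.1 - s * z.2) / (r * u - s * t)) +
        s * ((r * z.2 - t * z.1) / (r * u - s * t)) = z.1
      rw [mul_div_assoc', mul_div_assoc', ← add_div, div_eq_iff h]; ring
    · show t * ((u * z.1 - s * z.2) / (r * u - s * t)) +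
        u * ((r * z.2 - t * z.1) / (r * u - s * t)) = z.2
      rw [mul_div_assoc', mul_div_assoc', ← add_div, div_eq_iff h]; ring
  map_add' z w := by
    ext
    · show r * (z.1 + w.1) + s * (z.2 + w.2) = r * z.1 + s * z.2 + (r * w.1 + s * w.2)
      ring
    · show t * (z.1 + w.1) + u * (z.2 + w.2) = t * z.1 + u * z.2 + (t * w.1 + u * w.2)
      ring

theorem linEquivFn_of_matrix {f g : K × K → K × K} (r s t u r' s' t' u' : K)
    (h : r * u - s * t ≠ 0) (h' : r' * u' - s' * t' ≠ 0)
    (hfg : ∀ x y, f (x, y) = (r' * (g (r * x + s * y, t * x + u * y)).1 +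
      s' * (g (r * x + s * y, t * x + u * y)).2, t' * (g (r * x + s * y, t * x + u * y)).1 +
      u' * (g (r * x + s * y, t * x + u * y)).2)) : LinEquivFn f g :=
  ⟨prodAddEquiv r' s' t' u' h', prodAddEquiv r s t u h, funext fun ⟨x, y⟩ => hfg x y⟩

variable {a₀ a₁ a₂ a₃ b₀ b₁ b₂ b₃ : K}

theorem formMap_eq_zero (hodd : Odd Q) (hf : IsPlanarFn (formMap Q a₀ a₁ a₂ a₃ b₀ b₁ b₂ b₃))
    {s t : K} (h1 : a₀ * s ^ Q * s + a₁ * s ^ Q * t + a₂ * t ^ Q * s + a₃ * t ^ Q * t = 0)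
    (h2 : b₀ * s ^ Q * s + b₁ * s ^ Q * t + b₂ * t ^ Q * s + b₃ * t ^ Q * t = 0) :
    s = 0 ∧ t = 0 := by
  have : (s, t) = 0 := hf.eq_zero_of_apply (fun z => by
    simp only [formMap, Prod.fst_neg, Prod.snd_neg, hodd.neg_pow]; ext <;> simp) (by
    simp [formMap, h1, h2, hodd.pos.ne'])
  exact Prod.mk_eq_zero.1 this

theorem formMap_add_sub (hQ : ∀ x y : K, (x + y) ^ Q = x ^ Q + y ^ Q) (s t X Y : K) :
    formMap Q a₀ a₁ a₂ a₃ b₀ b₁ b₂ b₃ ((X, Y) + (s, t)) - formMap Q a₀ a₁ a₂ a₃ b₀ b₁ b₂ b₃ (X, Y)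
      = (a₀ * (X ^ Q * s + s ^ Q * X) + a₁ * (X ^ Q * t + s ^ Q * Y) +
          a₂ * (Y ^ Q * s + t ^ Q * X) + a₃ * (Y ^ Q * t + t ^ Q * Y),
         b₀ * (X ^ Q * s + s ^ Q * X) + b₁ * (X ^ Q * t + s ^ Q * Y) +
          b₂ * (Y ^ Q * s + t ^ Q * X) + b₃ * (Y ^ Q * t + t ^ Q * Y)) +
        formMap Q a₀ a₁ a₂ a₃ b₀ b₁ b₂ b₃ (s, t) := by
  simp only [formMap, Prod.mk_add_mk, hQ]
  ext <;> simp <;> ring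

theorem formMap_polar_eq_zero (h0 : Q ≠ 0) (hQ : ∀ x y : K, (x + y) ^ Q = x ^ Q + y ^ Q)
    (hf : IsPlanarFn (formMap Q a₀ a₁ a₂ a₃ b₀ b₁ b₂ b₃)) {s t X Y : K} (hst : s ≠ 0 ∨ t ≠ 0)
    (h1 : a₀ * (X ^ Q * s + s ^ Q * X) + a₁ * (X ^ Q * t + s ^ Q * Y) +
          a₂ * (Y ^ Q * s + t ^ Q * X) + a₃ * (Y ^ Q * t + t ^ Q * Y) = 0)
    (h2 : b₀ * (X ^ Q * s + s ^ Q * X) + b₁ * (X ^ Q * t + s ^ Q * Y) +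
          b₂ * (Y ^ Q * s + t ^ Q * X) + b₃ * (Y ^ Q * t + t ^ Q * Y) = 0) :
    X = 0 ∧ Y = 0 := by
  have : (X, Y) = 0 := hf.eq_zero_of_add (a := (s, t))
    (by rw [Ne, Prod.mk_eq_zero, not_and_or]; exact hst) (by
      rw [formMap_add_sub hQ, h1, h2]; simp [formMap, h0])
  exact Prod.mk_eq_zero.1 this

theorem formMap_exists_polar (hQ : ∀ x y : K, (x + y) ^ Q = x ^ Q + y ^ Q)
    (hf : IsPlanarFn (formMap Q a₀ a₁ a₂ a₃ b₀ b₁ b₂ b₃)) {s t : K} (hst : s ≠ 0 ∨ t ≠ 0)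
    (c : K) : ∃ X Y, a₀ * (X ^ Q * s + s ^ Q * X) + a₁ * (X ^ Q * t + s ^ Q * Y) +
          a₂ * (Y ^ Q * s + t ^ Q * X) + a₃ * (Y ^ Q * t + t ^ Q * Y) = c := by
  obtain ⟨⟨X, Y⟩, h, -⟩ := hf (s, t) (by rw [Ne, Prod.mk_eq_zero, not_and_or]; exact hst)
    ((c, 0) + formMap Q a₀ a₁ a₂ a₃ b₀ b₁ b₂ b₃ (s, t))
  refine ⟨X, Y, ?_⟩
  rw [formMap_add_sub hQ] at h
  exact congrArg Prod.fst (add_right_cancel h)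

theorem half_sum_identities (hQ : ∀ x y : K, (x + y) ^ Q = x ^ Q + y ^ Q) (h2 : (2 : K) ≠ 0)
    {s w κ : K} (h : (s ^ Q + s) ^ 2 = (w ^ Q - w) ^ 2 + 4 * κ * w ^ (Q + 1)) :
    (((s + w) / 2) ^ Q + (s - w) / 2) * (((s - w) / 2) ^ Q + (s + w) / 2) = κ * w ^ (Q + 1) ∧
    (((s + w) / 2) ^ Q + (s + w) / 2) * (((s - w) / 2) ^ Q + (s - w) / 2) =
      (κ - 1) * w ^ (Q + 1) := by
  have h2Q : (2 : K) ^ Q = 2 := by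
    have := hQ 1 1
    rwa [one_pow, one_add_one_eq_two] at this
  have h4 : (4 : K) ≠ 0 := by rw [show (4 : K) = 2 ^ 2 by norm_num]; exact pow_ne_zero _ h2
  simp only [div_pow, h2Q, hQ, sub_pow_of_add_pow hQ]
  constructor
  · field_simp; linear_combination h
  · field_simp; linear_combination h

theorem not_isPlanarFn_formMap_of_isSquare [Finite K] (hodd : Odd Q)
    (hQ : ∀ x y : K, (x + y) ^ Q = x ^ Q + y ^ Q) (h2 : (2 : K) ≠ 0)
    (h0 : ∀ u : K, u ^ Q + u = 0 → u = 0)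
    (hsq : ∀ κ : K, κ ≠ 0 → κ ≠ 1 →
      ∃ y : K, y ≠ 0 ∧ IsSquare ((y ^ Q - y) ^ 2 + 4 * κ * y ^ (Q + 1)))
    {α β γ δ : K} : ¬ IsPlanarFn (formMap Q α β 0 0 0 0 γ δ) := by
  intro hf
  have hQ0 : Q ≠ 0 := hodd.pos.ne'
  have hbij := bijective_pow_add_self hQ h0
  have hα : α ≠ 0 := by
    rintro rfl
    exact one_ne_zero (formMap_eq_zero hodd hf (s := 1) (t := 0) (by simp [hQ0])
      (by simp [hQ0])).1
  have hδ : δ ≠ 0 := by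
    rintro rfl
    exact one_ne_zero (formMap_eq_zero hodd hf (s := 0) (t := 1) (by simp [hQ0])
      (by simp [hQ0])).2
  have hγ : γ ≠ 0 := by
    rintro rfl
    obtain ⟨X, hX⟩ := hbij.2 (-β / α)
    simp only [] at hX
    refine one_ne_zero (formMap_polar_eq_zero hQ0 hQ hf (s := 1) (t := 0) (X := X) (Y := 1)
      (Or.inl one_ne_zero) ?_ ?_).2
    · simp [hQ0, hX]; field_simp; ring
    · simp [hQ0]
  have hβ : β ≠ 0 := by
    rintro rfl
    obtain ⟨Y, hY⟩ := hbij.2 (-γ / δ)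
    simp only [] at hY
    refine one_ne_zero (formMap_polar_eq_zero hQ0 hQ hf (s := 0) (t := 1) (X := 1) (Y := Y)
      (Or.inr one_ne_zero) ?_ ?_).1
    · simp [hQ0]
    · simp [hQ0, hY]; field_simp; ring
  have hdet : α * δ - β * γ ≠ 0 := by
    intro h
    refine hβ (formMap_eq_zero hodd hf (s := β) (t := -α) (by ring) ?_).1
    linear_combination - (-α) ^ Q * h
  obtain ⟨κ, hκ⟩ : ∃ κ, κ * (α * δ - β * γ) = α * δ := ⟨α * δ / (α * δ - β * γ), by field_simp⟩
  have hκ0 : κ ≠ 0 := by rintro rfl; rw [zero_mul] at hκ; exact mul_ne_zero hα hδ hκ.symm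
  have hκ1 : κ ≠ 1 := by
    rintro rfl
    exact mul_ne_zero hβ hγ (by linear_combination -hκ)
  obtain ⟨y, hy, T, hT⟩ := hsq κ hκ0 hκ1
  obtain ⟨s₀, hs₀⟩ := hbij.2 T
  simp only [] at hs₀
  obtain ⟨hi1, hi2⟩ := half_sum_identities hQ h2 (s := s₀) (w := y) (κ := κ)
    (by rw [hs₀, hT, sq])
  have huv : (s₀ + y) / 2 - (s₀ - y) / 2 = y := by field_simp; ring
  set u := (s₀ + y) / 2
  set v := (s₀ - y) / 2
  have hn1 : u ^ Q + v ≠ 0 :=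
    left_ne_zero_of_mul (by rw [hi1]; exact mul_ne_zero hκ0 (pow_ne_zero _ hy))
  have hn2 : u ^ Q + u ≠ 0 :=
    left_ne_zero_of_mul (by rw [hi2]; exact mul_ne_zero (sub_ne_zero.2 hκ1) (pow_ne_zero _ hy))
  have hs : β * (u ^ Q + v) ≠ 0 := mul_ne_zero hβ hn1
  have ht : -α * (u ^ Q + u) ≠ 0 := mul_ne_zero (neg_ne_zero.2 hα) hn2
  have hker := formMap_polar_eq_zero hQ0 hQ hf (s := β * (u ^ Q + v)) (t := -α * (u ^ Q + u))
    (X := β * (u ^ Q + v) * u) (Y := -α * (u ^ Q + u) * v) (Or.inl hs)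
    (by rw [mul_pow _ u]; ring) (by
      rw [mul_pow _ v]
      linear_combination (-α * (u ^ Q + u)) ^ Q * (γ * β * hi1 - δ * α * hi2 - y ^ (Q + 1) * hκ))
  have hu : u = 0 := (mul_eq_zero.1 hker.1).resolve_left hs
  have hv : v = 0 := (mul_eq_zero.1 hker.2).resolve_left ht
  exact hy (by rw [← huv, hu, hv, sub_zero])

end Forms

section Degenerate

variable {K : Type*} [Field K] {Q : ℕ} {a₀ a₁ a₂ a₃ b₀ b₁ b₂ b₃ : K}

theorem linEquivFn_formMap_comp (hQ : ∀ x y : K, (x + y) ^ Q = x ^ Q + y ^ Q) (r s t u : K)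
    (h : r * u - s * t ≠ 0) :
    LinEquivFn (formMap Q
      (a₀ * r ^ Q * r + a₁ * r ^ Q * t + a₂ * t ^ Q * r + a₃ * t ^ Q * t)
      (a₀ * r ^ Q * s + a₁ * r ^ Q * u + a₂ * t ^ Q * s + a₃ * t ^ Q * u)
      (a₀ * s ^ Q * r + a₁ * s ^ Q * t + a₂ * u ^ Q * r + a₃ * u ^ Q * t)
      (a₀ * s ^ Q * s + a₁ * s ^ Q * u + a₂ * u ^ Q * s + a₃ * u ^ Q * u)
      (b₀ * r ^ Q * r + b₁ * r ^ Q * t + b₂ * t ^ Q * r + b₃ * t ^ Q * t)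
      (b₀ * r ^ Q * s + b₁ * r ^ Q * u + b₂ * t ^ Q * s + b₃ * t ^ Q * u)
      (b₀ * s ^ Q * r + b₁ * s ^ Q * t + b₂ * u ^ Q * r + b₃ * u ^ Q * t)
      (b₀ * s ^ Q * s + b₁ * s ^ Q * u + b₂ * u ^ Q * s + b₃ * u ^ Q * u))
      (formMap Q a₀ a₁ a₂ a₃ b₀ b₁ b₂ b₃) := by
  refine linEquivFn_of_matrix r s t u 1 0 0 1 h (by simp) fun x y => ?_
  simp only [formMap, hQ, mul_pow]
  ext <;> simp only <;> ring

theorem exists_linEquivFn_formMap_of_mul (hQ : ∀ x y : K, (x + y) ^ Q = x ^ Q + y ^ Q)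
    (hQ0 : Q ≠ 0) {α β γ δ : K} (h : α * δ - β * γ ≠ 0) : ∃ c₀ c₁ c₂ c₃ : K,
    LinEquivFn (formMap Q (α ^ Q * γ) (α ^ Q * δ) (β ^ Q * γ) (β ^ Q * δ) b₀ b₁ b₂ b₃)
      (formMap Q 0 1 0 0 c₀ c₁ c₂ c₃) := by
  obtain ⟨Δ, hΔ⟩ : ∃ Δ, Δ = α * δ - β * γ := ⟨_, rfl⟩
  rw [← hΔ] at h
  have hco : ∀ x y z w : K, α ^ Q * γ * x ^ Q * y + α ^ Q * δ * x ^ Q * w + β ^ Q * γ * z ^ Q * y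
      + β ^ Q * δ * z ^ Q * w = (α * x + β * z) ^ Q * (γ * y + δ * w) := by
    intro x y z w; rw [hQ, mul_pow, mul_pow]; ring
  have key := linEquivFn_formMap_comp (a₀ := α ^ Q * γ) (a₁ := α ^ Q * δ) (a₂ := β ^ Q * γ)
    (a₃ := β ^ Q * δ) (b₀ := b₀) (b₁ := b₁) (b₂ := b₂) (b₃ := b₃) hQ (δ / Δ) (-β / Δ) (-γ / Δ)
    (α / Δ) (by
      have : δ / Δ * (α / Δ) - -β / Δ * (-γ / Δ) = Δ⁻¹ := by
        field_simp; rw [hΔ]; ring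
      rw [this]; exact inv_ne_zero h)
  have e1 : α * (δ / Δ) + β * (-γ / Δ) = 1 := by field_simp; rw [hΔ]; ring
  have e2 : γ * (δ / Δ) + δ * (-γ / Δ) = 0 := by ring
  have e3 : α * (-β / Δ) + β * (α / Δ) = 0 := by ring
  have e4 : γ * (-β / Δ) + δ * (α / Δ) = 1 := by field_simp; rw [hΔ]; ring
  rw [hco, hco, hco, hco, e1, e2, e3, e4, one_pow, zero_pow hQ0, mul_zero, mul_zero, one_mul,
    zero_mul] at key
  exact ⟨_, _, _, _, key.symm⟩

theorem exists_mul_of_det_eq_zero (h : a₀ * a₃ = a₁ * a₂) : ∃ α β γ δ : K, (α ≠ 0 ∨ β ≠ 0) ∧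
    a₀ = α * γ ∧ a₁ = α * δ ∧ a₂ = β * γ ∧ a₃ = β * δ := by
  by_cases h0 : a₀ = 0
  · by_cases h1 : a₁ = 0
    · exact ⟨0, 1, a₂, a₃, Or.inr one_ne_zero, by simp [h0], by simp [h1], by simp, by simp⟩
    · refine ⟨1, a₃ / a₁, a₀, a₁, Or.inl one_ne_zero, by simp, by simp, ?_, by field_simp⟩
      have : a₂ = 0 := by rw [h0, zero_mul] at h; simpa [h1] using h.symm
      rw [h0, this, mul_zero]
  · refine ⟨1, a₂ / a₀, a₀, a₁, Or.inl one_ne_zero, by simp, by simp, by field_simp, ?_⟩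
    field_simp; linear_combination h

theorem exists_linEquivFn_of_diag [Finite K] (hodd : Odd Q)
    (hQ : ∀ x y : K, (x + y) ^ Q = x ^ Q + y ^ Q) (h0 : ∀ u : K, u ^ Q + u = 0 → u = 0)
    (hf : IsPlanarFn (formMap Q 0 1 0 0 b₀ 0 0 b₃)) :
    ∃ ε : K, ε ≠ 0 ∧ (¬ ∃ z : K, z ^ 2 = ε) ∧ LinEquivFn (formMap Q 0 1 0 0 b₀ 0 0 b₃)
      (fun xy : K × K => (xy.1 ^ Q * xy.2, xy.1 ^ (Q + 1) + ε * xy.2 ^ (Q + 1))) := by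
  have hQ0 : Q ≠ 0 := hodd.pos.ne'
  have hb₀ : b₀ ≠ 0 := by
    rintro rfl
    exact one_ne_zero (formMap_eq_zero hodd hf (s := 1) (t := 0) (by simp [hQ0])
      (by simp [hQ0])).1
  have hb₃ : b₃ ≠ 0 := by
    rintro rfl
    exact one_ne_zero (formMap_eq_zero hodd hf (s := 0) (t := 1) (by simp [hQ0])
      (by simp [hQ0])).2
  refine ⟨b₃ / b₀, div_ne_zero hb₃ hb₀, ?_, ?_⟩
  · rintro ⟨z, hz⟩
    have hz0 : z ≠ 0 := by rintro rfl; exact div_ne_zero hb₃ hb₀ (by rw [← hz]; simp)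
    have hb : b₃ = b₀ * z ^ 2 := by rw [hz]; field_simp
    obtain ⟨u, hu⟩ := (bijective_pow_add_self hQ h0).2 z
    simp only [] at hu
    have h1 := (formMap_polar_eq_zero hQ0 hQ hf (s := z) (t := 1) (X := z * u) (Y := -u ^ Q)
      (Or.inl hz0) (by rw [mul_pow]; ring) (by
        have h2 : (u ^ Q) ^ Q + u ^ Q = z ^ Q := by rw [← hQ, hu]
        rw [hodd.neg_pow, mul_pow, hb, one_pow]
        linear_combination b₀ * z ^ Q * z * hu - b₀ * z ^ 2 * h2)).1
    have hu0 : u = 0 := (mul_eq_zero.1 h1).resolve_left hz0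
    rw [hu0, zero_pow hQ0, zero_add] at hu
    exact hz0 hu.symm
  · refine linEquivFn_of_matrix 1 0 0 1 1 0 0 b₀ (by simp) (by simpa using hb₀) fun x y => ?_
    simp only [formMap]
    ext
    · simp
    · simp only; field_simp; ring

theorem exists_linEquivFn_of_det_eq_zero [Finite K] (hodd : Odd Q)
    (hQ : ∀ x y : K, (x + y) ^ Q = x ^ Q + y ^ Q) (h2 : (2 : K) ≠ 0)
    (h0 : ∀ u : K, u ^ Q + u = 0 → u = 0)
    (hsq : (∀ x : K, x ^ Q = x) ∨ ∀ κ : K, κ ≠ 0 → κ ≠ 1 →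
      ∃ y : K, y ≠ 0 ∧ IsSquare ((y ^ Q - y) ^ 2 + 4 * κ * y ^ (Q + 1)))
    (hf : IsPlanarFn (formMap Q a₀ a₁ a₂ a₃ b₀ b₁ b₂ b₃)) (hdet : a₀ * a₃ = a₁ * a₂) :
    ∃ ε : K, ε ≠ 0 ∧ (¬ ∃ z : K, z ^ 2 = ε) ∧ LinEquivFn (formMap Q a₀ a₁ a₂ a₃ b₀ b₁ b₂ b₃)
      (fun xy : K × K => (xy.1 ^ Q * xy.2, xy.1 ^ (Q + 1) + ε * xy.2 ^ (Q + 1))) := by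
  have hQ0 : Q ≠ 0 := hodd.pos.ne'
  have hpow := (bijective_pow_of_add_pow hQ0 hQ).2
  obtain ⟨α', β', γ, δ, hαβ, rfl, rfl, rfl, rfl⟩ := exists_mul_of_det_eq_zero hdet
  obtain ⟨α, rfl⟩ := hpow α'
  obtain ⟨β, rfl⟩ := hpow β'
  simp only [ne_eq, pow_eq_zero_iff hQ0] at hαβ hf ⊢
  by_cases hΔ : α * δ - β * γ = 0
  · exfalso
    obtain ⟨X, Y, h⟩ := formMap_exists_polar hQ hf (s := β) (t := -α)
      (by rw [neg_ne_zero]; exact hαβ.symm) 1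
    refine one_ne_zero (h.symm.trans ?_)
    rw [hodd.neg_pow]
    linear_combination (-α ^ Q * X ^ Q - β ^ Q * Y ^ Q) * hΔ
  obtain ⟨b₀, b₁, b₂, b₃, he⟩ := exists_linEquivFn_formMap_of_mul (b₀ := b₀) (b₁ := b₁) (b₂ := b₂)
    (b₃ := b₃) hQ hQ0 hΔ
  have hf' := hf.of_linEquivFn he.symm
  have he2 : ∀ b₁ b₂, LinEquivFn (formMap Q 0 1 0 0 b₀ b₁ b₂ b₃)
      (formMap Q 0 1 0 0 b₀ 0 b₂ b₃) := fun b₁ b₂ => by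
    refine linEquivFn_of_matrix 1 0 0 1 1 0 b₁ 1 (by simp) (by simp) fun x y => ?_
    simp only [formMap]
    ext <;> simp
    ring
  suffices LinEquivFn (formMap Q 0 1 0 0 b₀ b₁ b₂ b₃) (formMap Q 0 1 0 0 b₀ 0 0 b₃) by
    obtain ⟨ε, hε, hε', h⟩ := exists_linEquivFn_of_diag hodd hQ h0 (hf'.of_linEquivFn this.symm)
    exact ⟨ε, hε, hε', he.trans (this.trans h)⟩
  rcases hsq with hlin | hsq
  · have : formMap Q 0 1 0 0 b₀ b₁ b₂ b₃ = formMap Q 0 1 0 0 b₀ (b₁ + b₂) 0 b₃ := by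
      ext <;> simp only [formMap, hlin]
      ring
    rw [this]
    exact he2 _ _
  · by_cases hb₂ : b₂ = 0
    · subst hb₂; exact he2 _ _
    exfalso
    obtain ⟨r, hr⟩ := hpow b₀
    obtain ⟨s, hs⟩ := hpow b₂
    simp only [] at hr hs
    have hs0 : s ≠ 0 := by rintro rfl; exact hb₂ (by rw [← hs, zero_pow hQ0])
    have he3 : LinEquivFn (formMap Q 0 1 0 0 b₀ 0 b₂ b₃)
        (formMap Q (-r / s) (1 / s) 0 0 0 0 (1 - b₃ / b₂ * (r / s)) (b₃ / b₂ / s)) := by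
      refine linEquivFn_of_matrix 1 0 r s 1 0 (-(b₀ * b₃ / b₂)) 1 (by simpa using hs0) (by simp)
        fun x y => ?_
      simp only [formMap, hQ, mul_pow, hr, hs, zero_pow hQ0, one_pow]
      ext
      · simp only; field_simp; ring
      · simp only; field_simp; ring
    exact not_isPlanarFn_formMap_of_isSquare hodd hQ h2 h0 hsq
      ((hf'.of_linEquivFn (he2 b₁ b₂).symm).of_linEquivFn he3.symm)

theorem linEquivFn_formMap_combination {s t : K} (hst : s ≠ 0 ∨ t ≠ 0) : ∃ c₀ c₁ c₂ c₃ : K,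
    LinEquivFn (formMap Q a₀ a₁ a₂ a₃ b₀ b₁ b₂ b₃)
      (formMap Q (s * a₀ + t * b₀) (s * a₁ + t * b₁) (s * a₂ + t * b₂) (s * a₃ + t * b₃)
        c₀ c₁ c₂ c₃) := by
  rcases hst with h | h
  · refine ⟨b₀, b₁, b₂, b₃, LinEquivFn.symm ?_⟩
    refine linEquivFn_of_matrix 1 0 0 1 s t 0 1 (by simp) (by simpa using h) fun x y => ?_
    simp only [formMap]
    ext <;> simp only <;> ring
  · refine ⟨a₀, a₁, a₂, a₃, LinEquivFn.symm ?_⟩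
    refine linEquivFn_of_matrix 1 0 0 1 s t 1 0 (by simp) (by simpa using h) fun x y => ?_
    simp only [formMap]
    ext <;> simp only <;> ring

open Polynomial in
theorem exists_isSquare_binary [Fintype K] (h2 : (2 : K) ≠ 0) (A B C : K) :
    ∃ s t : K, (s ≠ 0 ∨ t ≠ 0) ∧ IsSquare (A * s ^ 2 + B * s * t + C * t ^ 2) := by
  by_cases hA : A = 0
  · exact ⟨1, 0, Or.inl one_ne_zero, by simp [hA]⟩
  obtain ⟨s, r, h⟩ := FiniteField.exists_root_sum_quadratic (R := K)
    (f := Polynomial.C A * X ^ 2 + Polynomial.C B * X + Polynomial.C C) (g := -X ^ 2)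
    (degree_quadratic hA) (by simp) (by
      refine FiniteField.odd_card_of_char_ne_two ?_
      intro h
      have := ringChar.Nat.cast_ringChar (R := K)
      rw [h] at this
      exact h2 (by exact_mod_cast this))
  refine ⟨s, 1, Or.inr one_ne_zero, r, ?_⟩
  simp at h
  linear_combination h

theorem exists_linEquivFn_of_linear [Fintype K] (hodd : Odd Q) (h2 : (2 : K) ≠ 0)
    (hlin : ∀ x : K, x ^ Q = x) (hf : IsPlanarFn (formMap Q a₀ a₁ a₂ a₃ b₀ b₁ b₂ b₃)) :
    ∃ ε : K, ε ≠ 0 ∧ (¬ ∃ z : K, z ^ 2 = ε) ∧ LinEquivFn (formMap Q a₀ a₁ a₂ a₃ b₀ b₁ b₂ b₃)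
      (fun xy : K × K => (xy.1 ^ Q * xy.2, xy.1 ^ (Q + 1) + ε * xy.2 ^ (Q + 1))) := by
  have hQ : ∀ x y : K, (x + y) ^ Q = x ^ Q + y ^ Q := by simp [hlin]
  have h0 : ∀ u : K, u ^ Q + u = 0 → u = 0 := fun u hu => by
    rw [hlin, ← two_mul] at hu; exact (mul_eq_zero.1 hu).resolve_left h2
  obtain ⟨s, t, hst, r, hr⟩ := exists_isSquare_binary h2 ((a₁ + a₂) ^ 2 - 4 * a₀ * a₃)
    (2 * (a₁ + a₂) * (b₁ + b₂) - 4 * (a₀ * b₃ + a₃ * b₀)) ((b₁ + b₂) ^ 2 - 4 * b₀ * b₃)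
  obtain ⟨c₀, c₁, c₂, c₃, he⟩ := linEquivFn_formMap_combination (Q := Q) (a₀ := a₀) (a₁ := a₁)
    (a₂ := a₂) (a₃ := a₃) (b₀ := b₀) (b₁ := b₁) (b₂ := b₂) (b₃ := b₃) hst
  obtain ⟨n, hn⟩ : ∃ n, n = s * (a₁ + a₂) + t * (b₁ + b₂) := ⟨_, rfl⟩
  have : formMap Q (s * a₀ + t * b₀) (s * a₁ + t * b₁) (s * a₂ + t * b₂) (s * a₃ + t * b₃)
      c₀ c₁ c₂ c₃ = formMap Q (s * a₀ + t * b₀) ((n + r) / 2) ((n - r) / 2) (s * a₃ + t * b₃)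
      c₀ c₁ c₂ c₃ := by
    ext
    · simp only [formMap, hlin]; field_simp; rw [hn]; ring
    · rfl
  rw [this] at he
  have h4 : (4 : K) ≠ 0 := by rw [show (4 : K) = 2 ^ 2 by norm_num]; exact pow_ne_zero _ h2
  obtain ⟨ε, hε, hε', h⟩ := exists_linEquivFn_of_det_eq_zero hodd hQ h2 h0 (Or.inl hlin)
    (hf.of_linEquivFn he.symm) (by
      have : (n + r) / 2 * ((n - r) / 2) = (n ^ 2 - r * r) / 4 := by field_simp; ring
      rw [this, ← hr, hn]; field_simp; ring)
  exact ⟨ε, hε, hε', he.trans h⟩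

end Degenerate

section Anisotropic

variable {F : Type*} [Field F] {q Q : ℕ}

theorem exists_pow_eq_mul_of_norm_eq_one (hq : ∀ x y : F, (x + y) ^ q = x ^ q + y ^ q)
    (hqq : ∀ x : F, (x ^ q) ^ q = x) {ω : F} (hω : ω ≠ 0) (hωq : ω ^ q = -ω) {c : F}
    (hc : c * c ^ q = 1) : ∃ a : F, a ≠ 0 ∧ a ^ q = c * a := by
  by_cases h : 1 + c ^ q = 0
  · refine ⟨ω, hω, ?_⟩
    rw [hωq]
    linear_combination ω * hc - ω * c * h
  · refine ⟨1 + c ^ q, h, ?_⟩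
    rw [hq, hqq, one_pow]
    linear_combination -hc

theorem not_isPlanarFn_of_exists_form (hqodd : Odd q) (hQodd : Odd Q)
    (hq : ∀ x y : F, (x + y) ^ q = x ^ q + y ^ q) (hQ : ∀ x y : F, (x + y) ^ Q = x ^ Q + y ^ Q)
    (hqq : ∀ x : F, (x ^ q) ^ q = x) (h2 : (2 : F) ≠ 0) {ω : F} (hω : ω ≠ 0) (hωq : ω ^ q = -ω)
    (hform : ∀ κ : F, κ ^ q = κ → κ ≠ 0 → κ ≠ 1 → ∃ s w : F, s ^ q = s ∧ w ^ q = -w ∧ w ≠ 0 ∧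
      (s ^ Q + s) ^ 2 = (w ^ Q - w) ^ 2 + 4 * κ * w ^ (Q + 1))
    {A B : F} (hA : A ≠ 0) (hB : B ≠ 0) :
    ¬ IsPlanarFn fun z : F => z ^ Q * (A * z + B * z ^ q) := by
  intro hf
  have hQ0 : Q ≠ 0 := hQodd.pos.ne'
  have hq0 : q ≠ 0 := hqodd.pos.ne'
  have hAB : A * A ^ q - B * B ^ q ≠ 0 := by
    intro h
    obtain ⟨a, ha, haq⟩ := exists_pow_eq_mul_of_norm_eq_one hq hqq hω hωq (c := -(A / B)) (by
      rw [hqodd.neg_pow, div_pow]; field_simp; linear_combination h)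
    refine ha (hf.eq_zero_of_apply (fun x => ?_) ?_)
    · simp only [hQodd.neg_pow, hqodd.neg_pow]; ring
    · simp only [zero_pow hQ0, zero_mul]
      rw [haq]; field_simp; ring
  obtain ⟨κ, hκ⟩ : ∃ κ, κ = A * A ^ q / (A * A ^ q - B * B ^ q) := ⟨_, rfl⟩
  have hκ' : κ * (A * A ^ q - B * B ^ q) = A * A ^ q := by rw [hκ]; field_simp
  have hκ0 : κ ≠ 0 := by
    rw [hκ]; exact div_ne_zero (mul_ne_zero hA (pow_ne_zero _ hA)) hAB
  have hκ1 : κ ≠ 1 := by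
    intro h
    rw [h] at hκ'
    exact mul_ne_zero hB (pow_ne_zero q hB) (by linear_combination -hκ')
  have hκq : κ ^ q = κ := by
    rw [hκ, div_pow, sub_pow_of_add_pow hq, mul_pow, mul_pow, hqq, hqq]; ring
  obtain ⟨s, w, hs, hw, hw0, hsw⟩ := hform κ hκq hκ0 hκ1
  obtain ⟨hi1, hi2⟩ := half_sum_identities hQ h2 hsw
  have h2q : (2 : F) ^ q = 2 := by
    have := hq 1 1
    rwa [one_pow, one_add_one_eq_two] at this
  have huv : (s + w) / 2 - (s - w) / 2 = w := by field_simp; ring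
  have huq : ((s + w) / 2) ^ q = (s - w) / 2 := by
    rw [div_pow, hq, hs, hw, h2q]; ring
  have hvq : ((s - w) / 2) ^ q = (s + w) / 2 := by rw [← huq, hqq]
  generalize (s + w) / 2 = u at *
  generalize (s - w) / 2 = v at *
  have hw1 : w ^ (Q + 1) ≠ 0 := pow_ne_zero _ hw0
  have hn1 : u ^ Q + v ≠ 0 := left_ne_zero_of_mul (by rw [hi1]; exact mul_ne_zero hκ0 hw1)
  have hn1' : v ^ Q + u ≠ 0 := right_ne_zero_of_mul (by rw [hi1]; exact mul_ne_zero hκ0 hw1)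
  obtain ⟨a, ha, haq⟩ := exists_pow_eq_mul_of_norm_eq_one hq hqq hω hωq
    (c := -(A * (u ^ Q + u) / (B * (u ^ Q + v)))) (by
      have e1 : (u ^ Q) ^ q = v ^ Q := by rw [pow_right_comm, huq]
      rw [hqodd.neg_pow, div_pow, mul_pow, mul_pow, hq, hq, e1, huq, hvq]
      have hB' : B ^ q ≠ 0 := pow_ne_zero q hB
      field_simp
      linear_combination A * A ^ q * hi2 - B * B ^ q * hi1 + w ^ (Q + 1) * hκ')
  have hu : a * u = 0 := by
    refine hf.eq_zero_of_add ha ?_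
    simp only [hQ, hq, mul_pow, huq, zero_pow hQ0]
    have : A * a * (u ^ Q + u) + B * a ^ q * (u ^ Q + v) = 0 := by
      rw [haq]; field_simp; ring
    linear_combination a ^ Q * this
  have hu0 : u = 0 := (mul_eq_zero.1 hu).resolve_left ha
  rw [hu0, zero_pow hq0] at huq
  exact hw0 (by rw [← huv, hu0, ← huq, sub_zero])

end Anisotropic

section Extension

theorem eq_zero_of_add_mul_eq_zero {K F : Type*} [Field K] [Field F] [Algebra K F] {θ : F} 
    (hθ : ∀ r : K, algebraMap K F r ≠ θ) (x y : K)
    (h : algebraMap K F x + θ * algebraMap K F y = 0) : x = 0 ∧ y = 0 := by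
  by_cases hy : y = 0
  · subst hy; simpa using h
  · exfalso
    have hy' : algebraMap K F y ≠ 0 := (map_ne_zero _).2 hy
    refine hθ (-x / y) ?_
    rw [map_div₀, map_neg]
    field_simp
    linear_combination -h

variable {K F : Type*} [Field K] [Fintype K] [Field F] [Fintype F] [Algebra K F] {q Q : ℕ}

/-- The additive map `K × K → F`, `(x, y) ↦ α x + β y`. -/
def combHom (K : Type*) {F : Type*} [Field K] [Field F] [Algebra K F] (α β : F) : K × K →+ F where
  toFun z := α * algebraMap K F z.1 + β * algebraMap K F z.2
  map_zero' := by simp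
  map_add' z w := by simp; ring

theorem combHom_bijective (hcard : Fintype.card F = Fintype.card K ^ 2) {α β : F}
    (h : ∀ x y : K, α * algebraMap K F x + β * algebraMap K F y = 0 → x = 0 ∧ y = 0) :
    Function.Bijective (combHom K α β) := by
  rw [Fintype.bijective_iff_injective_and_card]
  refine ⟨(injective_iff_map_eq_zero _).2 fun z hz => ?_, by rw [Fintype.card_prod, hcard, sq]⟩
  exact Prod.mk_eq_zero.2 (h _ _ hz)

theorem exists_linEquivFn_of_det_ne_zero (hQ0 : Q ≠ 0)
    (hcard : Fintype.card F = Fintype.card K ^ 2) (hqK : ∀ x : K, x ^ q = x)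
    (hq : ∀ x y : F, (x + y) ^ q = x ^ q + y ^ q) (hQ : ∀ x y : F, (x + y) ^ Q = x ^ Q + y ^ Q)
    (hfix : ∀ x : F, x ^ q = x → ∃ r : K, algebraMap K F r = x) (h2 : (2 : F) ≠ 0)
    (hsqrt : ∀ x : K, ∃ r : F, r ^ 2 = algebraMap K F x) {a₀ a₁ a₂ a₃ b₀ b₁ b₂ b₃ : K}
    (hD : ∀ s t : K, s ≠ 0 ∨ t ≠ 0 →
      (s * a₀ + t * b₀) * (s * a₃ + t * b₃) ≠ (s * a₁ + t * b₁) * (s * a₂ + t * b₂)) :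
    ∃ A B : F, LinEquivFn (formMap Q a₀ a₁ a₂ a₃ b₀ b₁ b₂ b₃)
      fun z : F => z ^ Q * (A * z + B * z ^ q) := by
  have hpow := (bijective_pow_of_add_pow hQ0 hQ).2
  have hinj := (algebraMap K F).injective
  have hqKF : ∀ x : K, algebraMap K F x ^ q = algebraMap K F x := fun x => by
    rw [← map_pow, hqK]
  have hDb : b₀ * b₃ - b₁ * b₂ ≠ 0 := by
    have := hD 0 1 (Or.inr one_ne_zero)
    simpa [sub_ne_zero] using this
  have hDa : a₀ * a₃ ≠ a₁ * a₂ := by simpa using hD 1 0 (Or.inl one_ne_zero)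
  obtain ⟨m, hm⟩ : ∃ m, m = a₀ * b₃ + a₃ * b₀ - a₁ * b₂ - a₂ * b₁ := ⟨_, rfl⟩
  obtain ⟨r, hr⟩ := hsqrt (m ^ 2 - 4 * (b₀ * b₃ - b₁ * b₂) * (a₀ * a₃ - a₁ * a₂))
  have hDb' : algebraMap K F (b₀ * b₃ - b₁ * b₂) ≠ 0 := (map_ne_zero _).2 hDb
  obtain ⟨θ, hθ⟩ : ∃ θ, θ = (-algebraMap K F m + r) / (2 * algebraMap K F (b₀ * b₃ - b₁ * b₂)) :=
    ⟨_, rfl⟩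
  have hroot : algebraMap K F (b₀ * b₃ - b₁ * b₂) * θ ^ 2 + algebraMap K F m * θ +
      algebraMap K F (a₀ * a₃ - a₁ * a₂) = 0 := by
    rw [map_sub, map_mul, map_mul, map_pow, map_ofNat] at hr
    rw [hθ]; field_simp; linear_combination hr
  have hθK : ∀ x : K, algebraMap K F x ≠ θ := by
    rintro x rfl
    refine hD 1 x (Or.inl one_ne_zero) (hinj ?_)
    rw [hm] at hroot
    simp only [map_sub, map_add, map_mul, map_one] at hroot ⊢
    linear_combination hroot
  obtain ⟨α', β', γ, δ, -, h0, h1, h2', h3⟩ := exists_mul_of_det_eq_zero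
    (a₀ := algebraMap K F a₀ + θ * algebraMap K F b₀)
    (a₁ := algebraMap K F a₁ + θ * algebraMap K F b₁)
    (a₂ := algebraMap K F a₂ + θ * algebraMap K F b₂)
    (a₃ := algebraMap K F a₃ + θ * algebraMap K F b₃) (by
      rw [hm] at hroot
      simp only [map_sub, map_add, map_mul] at hroot
      linear_combination hroot)
  obtain ⟨α, rfl⟩ := hpow α'
  obtain ⟨β, rfl⟩ := hpow β'
  dsimp only at h0 h1 h2' h3
  have hker : ∀ x y : K, α * algebraMap K F x + β * algebraMap K F y = 0 → x = 0 ∧ y = 0 := by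
    intro x y h
    have hp : α ^ Q * algebraMap K F (x ^ Q) + β ^ Q * algebraMap K F (y ^ Q) = 0 := by
      rw [map_pow, map_pow, ← mul_pow, ← mul_pow, ← hQ, h, zero_pow hQ0]
    have e1 := (eq_zero_of_add_mul_eq_zero hθK (a₀ * x ^ Q + a₂ * y ^ Q)
      (b₀ * x ^ Q + b₂ * y ^ Q) (by
        rw [map_add, map_add, map_mul, map_mul, map_mul, map_mul]
        linear_combination algebraMap K F (x ^ Q) * h0 + algebraMap K F (y ^ Q) * h2' +
          γ * hp)).1
    have e2 := (eq_zero_of_add_mul_eq_zero hθK (a₁ * x ^ Q + a₃ * y ^ Q)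
      (b₁ * x ^ Q + b₃ * y ^ Q) (by
        rw [map_add, map_add, map_mul, map_mul, map_mul, map_mul]
        linear_combination algebraMap K F (x ^ Q) * h1 + algebraMap K F (y ^ Q) * h3 +
          δ * hp)).1
    have e3 : (a₀ * a₃ - a₁ * a₂) * x ^ Q = 0 := by linear_combination a₃ * e1 - a₂ * e2
    have e4 : (a₀ * a₃ - a₁ * a₂) * y ^ Q = 0 := by linear_combination a₀ * e2 - a₁ * e1
    exact ⟨(pow_eq_zero_iff hQ0).1 ((mul_eq_zero.1 e3).resolve_left (sub_ne_zero.2 hDa)),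
      (pow_eq_zero_iff hQ0).1 ((mul_eq_zero.1 e4).resolve_left (sub_ne_zero.2 hDa))⟩
  have hα : α ≠ 0 := by
    rintro rfl
    exact one_ne_zero (hker 1 0 (by simp)).1
  have hΔ : α * β ^ q - β * α ^ q ≠ 0 := by
    intro h
    obtain ⟨c, hc⟩ := hfix (β / α) (by
      have := pow_ne_zero q hα
      rw [div_pow]; field_simp; linear_combination h)
    refine one_ne_zero (hker (-c) 1 ?_).2
    rw [map_neg, hc, map_one]; field_simp; ring
  obtain ⟨Δ, hΔ'⟩ : ∃ Δ, Δ = α * β ^ q - β * α ^ q := ⟨_, rfl⟩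
  rw [← hΔ'] at hΔ
  obtain ⟨A, hA⟩ : ∃ A, A = (γ * β ^ q - δ * α ^ q) / Δ := ⟨_, rfl⟩
  obtain ⟨B, hB⟩ : ∃ B, B = (α * δ - β * γ) / Δ := ⟨_, rfl⟩
  have hγ : A * α + B * α ^ q = γ := by
    rw [hA, hB]; field_simp; rw [hΔ']; ring
  have hδ : A * β + B * β ^ q = δ := by
    rw [hA, hB]; field_simp; rw [hΔ']; ring
  refine ⟨A, B, (AddEquiv.ofBijective _ (combHom_bijective (α := 1) (β := θ) hcard
    (by simpa using eq_zero_of_add_mul_eq_zero hθK))).symm,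
    AddEquiv.ofBijective _ (combHom_bijective hcard hker), ?_⟩
  funext ⟨x, y⟩
  rw [Function.comp_apply, Function.comp_apply, eq_comm, AddEquiv.symm_apply_eq]
  show (α * algebraMap K F x + β * algebraMap K F y) ^ Q *
    (A * (α * algebraMap K F x + β * algebraMap K F y) +
      B * (α * algebraMap K F x + β * algebraMap K F y) ^ q) =
    1 * algebraMap K F (_ + _ + _ + _) + θ * algebraMap K F (_ + _ + _ + _)
  simp only [hq, hQ, mul_pow, hqKF, map_add, map_mul, map_pow]
  set X := algebraMap K F x
  set Y := algebraMap K F y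
  linear_combination -(X ^ Q * X) * h0 - X ^ Q * Y * h1 - Y ^ Q * X * h2' - Y ^ Q * Y * h3 +
    (α ^ Q * X ^ Q + β ^ Q * Y ^ Q) * (X * hγ + Y * hδ)

end Extension

section Classification

theorem pow_pow_eq_of_dvd {R : Type*} [CommRing R] {p d n : ℕ} (hodd : Odd p) (hdn : d ∣ n) {ω : R}
    (h : ω ^ p ^ d = -ω) : ω ^ p ^ n = (-1) ^ (n / d) * ω := by
  have := pow_pow_eq_neg_one_pow_mul (Q := p ^ d) (s := 1) hodd.pow odd_one (u := ω) (by simpa)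
    (n / d)
  rwa [← pow_mul, Nat.mul_div_cancel' hdn, one_pow, pow_one] at this

theorem linEquivFn_const_mul {F : Type*} [Field F] {A : F} (hA : A ≠ 0) {f g : F → F}
    (h : ∀ x, f x = A * g x) : LinEquivFn f g :=
  ⟨{ Equiv.mulLeft₀ A hA with map_add' := mul_add A }, AddEquiv.refl F, funext h⟩

theorem exists_form_of_isSquare {K F : Type*} [Field K] [Field F] [Algebra K F] {q Q : ℕ}
    (hqK : ∀ x : K, x ^ q = x) (hfix : ∀ x : F, x ^ q = x → ∃ r : K, algebraMap K F r = x)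
    (hbij : Function.Bijective fun u : K => u ^ Q + u)
    (hsq : ∀ κ e : K, κ ≠ 0 → κ ≠ 1 → e ≠ 0 →
      ∃ y : K, y ≠ 0 ∧ IsSquare (e * ((y ^ Q - y) ^ 2 + 4 * κ * y ^ (Q + 1))))
    {ω : F} (hω : ω ≠ 0) (hωq : ω ^ q = -ω) (hωQ : ω ^ Q = ω ∨ ω ^ Q = -ω) {κ : F}
    (hκ : κ ^ q = κ) (hκ0 : κ ≠ 0) (hκ1 : κ ≠ 1) : ∃ s w : F, s ^ q = s ∧ w ^ q = -w ∧ w ≠ 0 ∧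
      (s ^ Q + s) ^ 2 = (w ^ Q - w) ^ 2 + 4 * κ * w ^ (Q + 1) := by
  have hqKF : ∀ x : K, algebraMap K F x ^ q = algebraMap K F x := fun x => by
    rw [← map_pow, hqK]
  obtain ⟨κ, rfl⟩ := hfix κ hκ
  obtain ⟨e, he⟩ := hfix (ω ^ 2) (by rw [pow_right_comm, hωq, neg_sq])
  have hκ0' : κ ≠ 0 := by rintro rfl; simp at hκ0
  have hκ1' : κ ≠ 1 := by rintro rfl; simp at hκ1
  have he0 : e ≠ 0 := by rintro rfl; exact pow_ne_zero 2 hω (by rw [← he, map_zero])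
  have main : ∀ κ' y : K, y ≠ 0 → IsSquare (e * ((y ^ Q - y) ^ 2 + 4 * κ' * y ^ (Q + 1))) →
      ((ω * algebraMap K F y) ^ Q - ω * algebraMap K F y) ^ 2 +
        4 * algebraMap K F κ * (ω * algebraMap K F y) ^ (Q + 1) =
      ω ^ 2 * ((algebraMap K F y ^ Q - algebraMap K F y) ^ 2 +
        4 * algebraMap K F κ' * algebraMap K F y ^ (Q + 1)) →
      ∃ s w : F, s ^ q = s ∧ w ^ q = -w ∧ w ≠ 0 ∧
      (s ^ Q + s) ^ 2 = (w ^ Q - w) ^ 2 + 4 * algebraMap K F κ * w ^ (Q + 1) := by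
    rintro κ' y hy ⟨T, hT⟩ h
    obtain ⟨s, hs⟩ := hbij.2 T
    refine ⟨algebraMap K F s, ω * algebraMap K F y, hqKF s, ?_, mul_ne_zero hω
      ((map_ne_zero _).2 hy), ?_⟩
    · rw [mul_pow, hωq, hqKF, neg_mul]
    · have h1 := congrArg (algebraMap K F) hT
      have h2 := congrArg (algebraMap K F) hs
      simp only [map_mul, map_add, map_sub, map_pow, map_ofNat] at h1 h2
      rw [h, h2, ← he]
      linear_combination -h1
  rcases hωQ with hωQ | hωQ
  · obtain ⟨y, hy, hT⟩ := hsq κ e hκ0' hκ1' he0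
    refine main κ y hy hT ?_
    simp only [pow_succ _ Q, mul_pow, hωQ]; ring
  · obtain ⟨y, hy, hT⟩ := hsq (1 - κ) e (sub_ne_zero.2 hκ1'.symm)
      (fun h => hκ0' (by linear_combination -h)) he0
    refine main (1 - κ) y hy hT ?_
    simp only [pow_succ _ Q, mul_pow, hωQ, map_sub, map_one]; ring

variable {K F : Type*} [Field K] [Fintype K] [Field F] [Fintype F] [Algebra K F] {q Q : ℕ}

theorem exists_linEquivFn_formMap (hQodd : Odd Q)
    (hcard : Fintype.card F = Fintype.card K ^ 2)
    (hq : ∀ x y : F, (x + y) ^ q = x ^ q + y ^ q) (hQ : ∀ x y : F, (x + y) ^ Q = x ^ Q + y ^ Q)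
    (hqK : ∀ x : K, x ^ q = x) {ω : F} (hω : ∀ r : K, algebraMap K F r ≠ ω) (hωq : ω ^ q = -ω)
    (c₀ c₁ c₂ c₃ : F) {f : F → F} (hf : ∀ x, f x = c₀ * x ^ (q * Q + q) + c₁ * x ^ (q * Q + 1) +
      c₂ * x ^ (Q + q) + c₃ * x ^ (Q + 1)) : ∃ a₀ a₁ a₂ a₃ b₀ b₁ b₂ b₃ : K,
    LinEquivFn f (formMap Q a₀ a₁ a₂ a₃ b₀ b₁ b₂ b₃) := by
  have hbij : Function.Bijective (combHom K 1 ω) := combHom_bijective hcard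
    (by simpa using eq_zero_of_add_mul_eq_zero hω)
  have hrep : ∀ C : F, ∃ a b : K, C = algebraMap K F a + ω * algebraMap K F b := fun C => by
    obtain ⟨⟨a, b⟩, h⟩ := hbij.2 C
    exact ⟨a, b, by rw [← h]; simp [combHom]⟩
  obtain ⟨a₀, b₀, h0⟩ := hrep (c₀ + c₁ + c₂ + c₃)
  obtain ⟨a₁, b₁, h1⟩ := hrep (ω * (-c₀ + c₁ - c₂ + c₃))
  obtain ⟨a₂, b₂, h2⟩ := hrep (ω ^ Q * (-c₀ - c₁ + c₂ + c₃))
  obtain ⟨a₃, b₃, h3⟩ := hrep (ω ^ Q * ω * (c₀ - c₁ - c₂ + c₃))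
  refine ⟨a₀, a₁, a₂, a₃, b₀, b₁, b₂, b₃, LinEquivFn.symm
    ⟨(AddEquiv.ofBijective _ hbij).symm, AddEquiv.ofBijective _ hbij, ?_⟩⟩
  funext ⟨x, y⟩
  rw [Function.comp_apply, Function.comp_apply, eq_comm, AddEquiv.symm_apply_eq]
  show f (1 * algebraMap K F x + ω * algebraMap K F y) =
    1 * algebraMap K F (_ + _ + _ + _) + ω * algebraMap K F (_ + _ + _ + _)
  have hqKF : ∀ x : K, algebraMap K F x ^ q = algebraMap K F x := fun x => by
    rw [← map_pow, hqK]
  have hneg : ∀ z : F, (-ω * z) ^ Q = -(ω ^ Q * z ^ Q) := fun z => by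
    rw [mul_pow, hQodd.neg_pow, neg_mul]
  rw [hf]
  simp only [pow_add, pow_mul, pow_one, one_mul, hq, hQ, mul_pow, hqKF, hωq, hneg, map_add, map_mul,
    map_pow]
  set X := algebraMap K F x
  set Y := algebraMap K F y
  linear_combination X ^ Q * X * h0 + X ^ Q * Y * h1 + Y ^ Q * X * h2 + Y ^ Q * Y * h3

theorem classification_of_isPlanarFn {p k ℓ : ℕ} (hp : p.Prime) (hodd : Odd p) (hk : 0 < k)
    (hl : 0 < ℓ) (hF : Fintype.card F = p ^ (2 * k)) (hK : Fintype.card K = p ^ k)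
    (c₀ c₁ c₂ c₃ : F) {f : F → F} (hf : ∀ x, f x = c₀ * x ^ (p ^ k * p ^ ℓ + p ^ k) +
      c₁ * x ^ (p ^ k * p ^ ℓ + 1) + c₂ * x ^ (p ^ ℓ + p ^ k) + c₃ * x ^ (p ^ ℓ + 1))
    (hplanar : IsPlanarFn f) :
      (Even (ℓ / k.gcd ℓ) ∧ LinEquivFn f (fun x : F => x ^ (p ^ ℓ + 1)))
      ∨ (Odd (k / k.gcd ℓ) ∧ Odd (ℓ / k.gcd ℓ) ∧ LinEquivFn f (fun x : F => x ^ (p ^ ℓ + p ^ k)))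
      ∨ (Odd (k / k.gcd ℓ) ∧ ∃ ε : K, ε ≠ 0 ∧ (¬ ∃ z : K, z ^ 2 = ε) ∧ LinEquivFn f
        (fun xy : K × K =>
          (xy.1 ^ p ^ ℓ * xy.2, xy.1 ^ (p ^ ℓ + 1) + ε * xy.2 ^ (p ^ ℓ + 1)))) := by
  have := Fact.mk hp
  have : CharP K p := charP_of_card_eq_prime_pow hK
  have : CharP F p := charP_of_card_eq_prime_pow hF
  have hp2 : p ≠ 2 := by rintro rfl; revert hodd; decide
  have hringK : ringChar K ≠ 2 := by rw [ringChar.eq K p]; exact hp2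
  have h2K : (2 : K) ≠ 0 := Ring.two_ne_zero hringK
  have h2F : (2 : F) ≠ 0 := Ring.two_ne_zero (by rw [ringChar.eq F p]; exact hp2)
  have hcard : Fintype.card F = Fintype.card K ^ 2 := by rw [hF, hK]; ring
  have hqodd : Odd (p ^ k) := hodd.pow
  have hQodd : Odd (p ^ ℓ) := hodd.pow
  have hq0 : p ^ k ≠ 0 := hqodd.pos.ne'
  have hQ0 : p ^ ℓ ≠ 0 := hQodd.pos.ne'
  have hqF : ∀ x y : F, (x + y) ^ p ^ k = x ^ p ^ k + y ^ p ^ k := fun x y =>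
    add_pow_char_pow _ _ _ _
  have hQF : ∀ x y : F, (x + y) ^ p ^ ℓ = x ^ p ^ ℓ + y ^ p ^ ℓ := fun x y =>
    add_pow_char_pow _ _ _ _
  have hQK : ∀ x y : K, (x + y) ^ p ^ ℓ = x ^ p ^ ℓ + y ^ p ^ ℓ := fun x y =>
    add_pow_char_pow _ _ _ _
  have hqK : ∀ x : K, x ^ p ^ k = x := fun x => by rw [← hK, FiniteField.pow_card]
  have hqq : ∀ x : F, (x ^ p ^ k) ^ p ^ k = x := fun x => by
    rw [← pow_mul, ← pow_add, ← two_mul, ← hF, FiniteField.pow_card]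
  have hqKF : ∀ x : K, algebraMap K F x ^ p ^ k = algebraMap K F x := fun x => by
    rw [← map_pow, hqK]
  have hnotK : ∀ {ω : F}, ω ≠ 0 → ω ^ p ^ k = -ω → ∀ r : K, algebraMap K F r ≠ ω := by
    rintro ω hω hωq r rfl
    exact hω (eq_zero_of_eq_neg_self hodd (by rw [← hωq, hqKF]))
  have hd0 : 0 < k.gcd ℓ := Nat.gcd_pos_of_pos_left _ hk
  have hdk := Nat.gcd_dvd_left k ℓ
  have hdl := Nat.gcd_dvd_right k ℓ
  have hcop : Nat.Coprime (k / k.gcd ℓ) (ℓ / k.gcd ℓ) := Nat.coprime_div_gcd_div_gcd hd0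
  obtain ⟨η, hη, hηq⟩ := exists_pow_eq_neg hp hodd hk hF dvd_rfl
  obtain ⟨a₀, a₁, a₂, a₃, b₀, b₁, b₂, b₃, he⟩ := exists_linEquivFn_formMap hQodd hcard hqF hQF
    hqK (hnotK hη hηq) hηq c₀ c₁ c₂ c₃ hf
  have hg := hplanar.of_linEquivFn he.symm
  have hkodd : Odd (k / k.gcd ℓ) := by
    by_contra hcon
    rw [Nat.not_odd_iff_even] at hcon
    have hlodd : Odd (ℓ / k.gcd ℓ) := by
      rw [← Nat.not_even_iff_odd]
      intro h
      exact Nat.not_coprime_of_dvd_of_dvd one_lt_two hcon.two_dvd h.two_dvd hcop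
    obtain ⟨ω, hω, hωd⟩ := exists_pow_eq_neg hp hodd hd0 hK (by
      obtain ⟨m, hm⟩ := hcon.two_dvd
      have h := Nat.div_mul_cancel hdk
      rw [hm] at h
      exact ⟨m, by linarith⟩)
    have hωQ := pow_pow_eq_of_dvd hodd hdl hωd
    rw [hlodd.neg_one_pow, neg_one_mul] at hωQ
    exact hω (formMap_polar_eq_zero hQ0 hQK hg (s := 1) (t := 0) (X := ω) (Y := 0)
      (Or.inl one_ne_zero) (by rw [hωQ, zero_pow hQ0, one_pow]; ring)
      (by rw [hωQ, zero_pow hQ0, one_pow]; ring)).1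
  have h0K : ∀ u : K, u ^ p ^ ℓ + u = 0 → u = 0 := fun u hu =>
    eq_zero_of_pow_add_self hodd hK hkodd hu
  by_cases hm : k / k.gcd ℓ = 1
  · have hkl : k ∣ ℓ := by
      rw [← Nat.div_mul_cancel hdk, hm, one_mul]; exact hdl
    have hlin : ∀ x : K, x ^ p ^ ℓ = x := fun x => by
      obtain ⟨j, rfl⟩ := hkl
      rw [pow_mul, ← hK, FiniteField.pow_card_pow]
    obtain ⟨ε, hε, hε', h⟩ := exists_linEquivFn_of_linear hQodd h2K hlin hg
    exact Or.inr (Or.inr ⟨hkodd, ε, hε, hε', he.trans h⟩)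
  have hm3 : 3 * k.gcd ℓ ≤ k := by
    obtain ⟨j, hj⟩ := hkodd
    calc 3 * k.gcd ℓ ≤ k / k.gcd ℓ * k.gcd ℓ := Nat.mul_le_mul_right _ (by omega)
      _ = k := Nat.div_mul_cancel hdk
  have hsq : ∀ κ e : K, κ ≠ 0 → κ ≠ 1 → e ≠ 0 →
      ∃ y : K, y ≠ 0 ∧ IsSquare (e * ((y ^ p ^ ℓ - y) ^ 2 + 4 * κ * y ^ (p ^ ℓ + 1))) :=
    fun κ e h0 h1 h => exists_isSquare_mul_form hp hodd rfl hK hF hl hm3 h0 h1 h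
  by_cases hroot : ∃ s t : K, (s ≠ 0 ∨ t ≠ 0) ∧
      (s * a₀ + t * b₀) * (s * a₃ + t * b₃) = (s * a₁ + t * b₁) * (s * a₂ + t * b₂)
  · obtain ⟨s, t, hst, hdet⟩ := hroot
    obtain ⟨d₀, d₁, d₂, d₃, he2⟩ := linEquivFn_formMap_combination (Q := p ^ ℓ) (a₀ := a₀)
      (a₁ := a₁) (a₂ := a₂) (a₃ := a₃) (b₀ := b₀) (b₁ := b₁) (b₂ := b₂) (b₃ := b₃) hst
    obtain ⟨ε, hε, hε', h⟩ := exists_linEquivFn_of_det_eq_zero hQodd hQK h2K h0K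
      (Or.inr fun κ h0 h1 => by simpa using hsq κ 1 h0 h1 one_ne_zero)
      (hg.of_linEquivFn he2.symm) hdet
    exact Or.inr (Or.inr ⟨hkodd, ε, hε, hε', he.trans (he2.trans h)⟩)
  push Not at hroot
  have hfix : ∀ x : F, x ^ p ^ k = x → ∃ r : K, algebraMap K F r = x := by
    intro x hx
    obtain ⟨⟨a, b⟩, hab⟩ := (combHom_bijective hcard (α := 1) (β := η)
      (by simpa using eq_zero_of_add_mul_eq_zero (hnotK hη hηq))).2 x
    have hab' : algebraMap K F a + η * algebraMap K F b = x := by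
      rw [← hab]; simp [combHom]
    have h1 : η * algebraMap K F b = 0 := by
      refine eq_zero_of_eq_neg_self hodd ?_
      have h2 : algebraMap K F a + -(η * algebraMap K F b) = x := by
        rw [← hx, ← hab', hqF, mul_pow, hqKF, hqKF, hηq, neg_mul]
      linear_combination hab' - h2
    exact ⟨a, by rw [← hab', h1, add_zero]⟩
  obtain ⟨A, B, he2⟩ := exists_linEquivFn_of_det_ne_zero hQ0 hcard hqK hqF hQF hfix h2F
    (exists_sq_eq_algebraMap hcard hringK) hroot
  have hH := hg.of_linEquivFn he2.symm
  obtain ⟨ω, hω, hωd⟩ := exists_pow_eq_neg hp hodd hd0 hF (Nat.mul_dvd_mul_left 2 hdk)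
  have hωq := pow_pow_eq_of_dvd hodd hdk hωd
  have hωQ := pow_pow_eq_of_dvd hodd hdl hωd
  rw [hkodd.neg_one_pow, neg_one_mul] at hωq
  have hAB : A ≠ 0 ∨ B ≠ 0 := by
    by_contra! h
    refine one_ne_zero (hH.eq_zero_of_add (a := 1) (x := 1) one_ne_zero ?_)
    simp [h.1, h.2]
  by_cases hB : B = 0
  · have hA := hAB.resolve_right (not_not.2 hB)
    have he3 := linEquivFn_const_mul hA (f := fun z : F => z ^ p ^ ℓ * (A * z + B * z ^ p ^ k))
      (g := fun z => z ^ (p ^ ℓ + 1)) fun x => by rw [hB]; ring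
    refine Or.inl ⟨?_, he.trans (he2.trans he3)⟩
    by_contra hcon
    rw [Nat.not_even_iff_odd] at hcon
    rw [hcon.neg_one_pow, neg_one_mul] at hωQ
    refine hω ((hH.of_linEquivFn he3.symm).eq_zero_of_add (a := 1) one_ne_zero ?_)
    simp only [pow_succ _ (p ^ ℓ), hQF, hωQ, one_pow, zero_pow hQ0]; ring
  by_cases hA : A = 0
  · have he3 := linEquivFn_const_mul hB (f := fun z : F => z ^ p ^ ℓ * (A * z + B * z ^ p ^ k))
      (g := fun z => z ^ (p ^ ℓ + p ^ k)) fun x => by rw [hA]; ring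
    refine Or.inr (Or.inl ⟨hkodd, ?_, he.trans (he2.trans he3)⟩)
    by_contra hcon
    rw [Nat.not_odd_iff_even] at hcon
    rw [hcon.neg_one_pow, one_mul] at hωQ
    refine hω ((hH.of_linEquivFn he3.symm).eq_zero_of_add (a := 1) one_ne_zero ?_)
    simp only [pow_add, hQF, hqF, hωQ, hωq, one_pow, zero_pow hQ0]; ring
  · refine absurd hH (not_isPlanarFn_of_exists_form hqodd hQodd hqF hQF hqq h2F hω hωq ?_ hA hB)
    intro κ hκ hκ0 hκ1
    refine exists_form_of_isSquare hqK hfix (bijective_pow_add_self hQK h0K) hsq hω hωq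
      ?_ hκ hκ0 hκ1
    rcases neg_one_pow_eq_or F (ℓ / k.gcd ℓ) with h | h
    · left; rw [hωQ, h, one_mul]
    · right; rw [hωQ, h, neg_one_mul]

end Classification

theorem stmt0 (p k ℓ : ℕ) (hp : p.Prime) (hodd : Odd p) (hk : 0 < k) (hl : 0 < ℓ)
    (q Q d : ℕ) (hq : q = p ^ k) (hQ : Q = p ^ ℓ) (hd : d = Nat.gcd k ℓ)
    (F K : Type) [Field F] [Fintype F] [Field K] [Fintype K]
    (hF : Fintype.card F = p ^ (2 * k)) (hK : Fintype.card K = p ^ k)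
    (c0 c1 c2 c3 : F) (f : F → F)
    (hf : ∀ x : F, f x = c0 * x ^ (q * Q + q) + c1 * x ^ (q * Q + 1)
        + c2 * x ^ (Q + q) + c3 * x ^ (Q + 1)) :
    IsPlanarFn f ↔
      ((Even (ℓ / d) ∧ LinEquivFn f (fun x : F => x ^ (Q + 1)))
      ∨ (Odd (k * ℓ / d ^ 2) ∧ LinEquivFn f (fun x : F => x ^ (Q + q)))
      ∨ (Odd (k / d) ∧ ∃ ε : K, ε ≠ 0 ∧ (¬ ∃ z : K, z ^ 2 = ε) ∧
          LinEquivFn f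
            (fun xy : K × K => (xy.1 ^ Q * xy.2, xy.1 ^ (Q + 1) + ε * xy.2 ^ (Q + 1))))) := by
  subst hq hQ hd
  have := Fact.mk hp
  have : CharP K p := charP_of_card_eq_prime_pow hK
  have : CharP F p := charP_of_card_eq_prime_pow hF
  have hdk := Nat.gcd_dvd_left k ℓ
  have hdl := Nat.gcd_dvd_right k ℓ
  have hd0 : 0 < k.gcd ℓ := Nat.gcd_pos_of_pos_left _ hk
  have hdiv : k * ℓ / k.gcd ℓ ^ 2 = k / k.gcd ℓ * (ℓ / k.gcd ℓ) := by
    rw [sq, Nat.div_mul_div_comm hdk hdl]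
  have hQF : ∀ x y : F, (x + y) ^ p ^ ℓ = x ^ p ^ ℓ + y ^ p ^ ℓ := fun x y =>
    add_pow_char_pow _ _ _ _
  constructor
  · intro hplanar
    let := ZMod.algebra K p
    let := ZMod.algebra F p
    have hfK : Module.finrank (ZMod p) K = k := Nat.pow_right_injective hp.two_le <| by
      simpa [ZMod.card] using (Module.card_eq_pow_finrank (K := ZMod p) (V := K)).symm.trans hK
    have hfF : Module.finrank (ZMod p) F = 2 * k := Nat.pow_right_injective hp.two_le <| by
      simpa [ZMod.card] using (Module.card_eq_pow_finrank (K := ZMod p) (V := F)).symm.trans hF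
    obtain ⟨φ⟩ := FiniteField.nonempty_algHom_of_finrank_dvd (F := ZMod p) (K := K) (L := F)
      (by rw [hfK, hfF]; exact Dvd.intro_left 2 rfl)
    let := φ.toRingHom.toAlgebra
    rcases classification_of_isPlanarFn (K := K) hp hodd hk hl hF hK c0 c1 c2 c3 hf hplanar with
      h | ⟨h1, h2, h⟩ | h
    · exact Or.inl h
    · exact Or.inr (Or.inl ⟨hdiv ▸ h1.mul h2, h⟩)
    · exact Or.inr (Or.inr h)
  · rintro (⟨he, h⟩ | ⟨ho, h⟩ | ⟨ho, ε, hε0, hε, h⟩)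
    · refine (isPlanarFn_pow_add hQF (fun x y => by simp) fun u hu => ?_).of_linEquivFn h
      refine eq_zero_of_pow_add_self hodd hF ?_ (by simpa using hu)
      obtain ⟨m, hm⟩ := he.two_dvd
      have hcop : Nat.Coprime (k / k.gcd ℓ) (ℓ / k.gcd ℓ) := Nat.coprime_div_gcd_div_gcd hd0
      have hkodd : Odd (k / k.gcd ℓ) := by
        rw [← Nat.not_even_iff_odd]
        exact fun h => Nat.not_coprime_of_dvd_of_dvd one_lt_two h.two_dvd he.two_dvd hcop
      have hgcd : (2 * k).gcd ℓ = 2 * k.gcd ℓ := by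
        have key : ∀ {a g : ℕ}, a.Coprime (2 * m) → (2 * (a * g)).gcd (2 * m * g) = 2 * g := by
          intro a g h
          rw [← mul_assoc, Nat.gcd_mul_right, Nat.gcd_mul_left, h.coprime_mul_left_right.gcd_eq_one,
            mul_one]
        have h := key (g := k.gcd ℓ) (hm ▸ hcop)
        rwa [← hm, Nat.div_mul_cancel hdk, Nat.div_mul_cancel hdl] at h
      rwa [hgcd, Nat.mul_div_mul_left _ _ two_pos]
    · rw [hdiv, Nat.odd_mul] at ho
      exact (isPlanarFn_pow_add hQF (fun x y => add_pow_char_pow _ _ _ _) fun u hu =>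
        eq_zero_of_pow_add_pow hodd hF ho.1 ho.2 hu).of_linEquivFn h
    · exact (isPlanarFn_prod hodd.pow (fun x y => add_pow_char_pow _ _ _ _)
        (fun u hu => eq_zero_of_pow_add_self hodd hK ho hu) hε0 hε).of_linEquivFn h
end

section
/- Let p be an odd prime, k and ℓ positive integers with k not dividing ℓ, q = p^k, Q = p^ℓ, and let ε ∈ F_q with ε ≠ 0 and ε ≠ −1. Then the map P3 : F_q × F_q → F_q × F_q defined by P3(x,y) = (x^{Q+1} − x^Q·y, x·y^Q + ε·y^{Q+1}) is not planar. -/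
section FiniteFieldForms

open MvPolynomial

/-- Restricting a homogeneous polynomial to two variables, one of them set to `1`, picks out its
coefficients at the monomials in these variables. -/
theorem coeff_aeval_pair {F : Type*} [Field F] {k N : ℕ} (g : MvPolynomial (Fin k) F)
    (hg : g.IsHomogeneous N) {i j : Fin k} (hij : i ≠ j) {a : ℕ} (ha : a ≤ N) :
    (aeval (fun s => if s = i then 1 else if s = j then Polynomial.X else 0) g :
      Polynomial F).coeff a = coeff (Finsupp.single i (N - a) + Finsupp.single j a) g := by
  set e₀ : Fin k →₀ ℕ := Finsupp.single i (N - a) + Finsupp.single j a with he₀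
  have hoff : ∀ e : Fin k →₀ ℕ, (∀ s, s ≠ i → s ≠ j → e s = 0) →
      ∏ s, (if s = i then 1 else if s = j then Polynomial.X else 0 : Polynomial F) ^ e s
        = Polynomial.X ^ e j := by
    intro e he
    rw [Finset.prod_eq_single j]
    · simp [hij.symm]
    · intro s _ hsj
      by_cases hsi : s = i
      · simp [hsi]
      · simp [he s hsi hsj]
    · simp
  rw [aeval_def, eval₂_eq', Polynomial.finsetSum_coeff, Finset.sum_eq_single e₀]
  · rw [hoff e₀ (fun s hi hj => by simp [he₀, hi, hj])]
    simp [Polynomial.algebraMap_eq, he₀, hij]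
  · intro e he hne
    rw [Polynomial.algebraMap_eq, Polynomial.coeff_C_mul]
    by_cases hz : ∀ s, s ≠ i → s ≠ j → e s = 0
    · rw [hoff e hz, Polynomial.coeff_X_pow, if_neg, mul_zero]
      intro hj
      apply hne
      have hdeg : ∑ s, e s = N := by
        rw [← Finsupp.degree_eq_sum]
        by_contra hcon
        exact mem_support_iff.mp he (hg.coeff_eq_zero hcon)
      have h2 : e i + e j = N := by
        rw [← hdeg, ← Finset.sum_pair hij]
        exact Finset.sum_subset (Finset.subset_univ _) fun s _ hs => by
          simp only [Finset.mem_insert, Finset.mem_singleton, not_or] at hs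
          exact hz s hs.1 hs.2
      ext s
      by_cases hsi : s = i
      · subst hsi
        simp [he₀, hij]
        omega
      · by_cases hsj : s = j
        · subst hsj
          simp [he₀, hij, hj]
        · simp [he₀, hz s hsi hsj, Ne.symm hsi, Ne.symm hsj]
    · push Not at hz
      obtain ⟨s, hsi, hsj, hs⟩ := hz
      rw [Finset.prod_eq_zero (Finset.mem_univ s)]
      · simp
      · simp [hsi, hsj, hs]
  · intro h
    rw [notMem_support_iff.mp h]
    simp

theorem sum_geom_mul_pred {p : ℕ} [Fact p.Prime] (k : ℕ) :
    ∑ j : Fin k, p ^ (j : ℕ) * (p - 1) = p ^ k - 1 := by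
  rw [← Finset.sum_mul, Fin.sum_univ_eq_sum_range (fun j => p ^ j) k]
  exact geom_sum_mul_of_one_le (Fact.out : p.Prime).one_le k

theorem prod_pow_pow_half {F : Type*} [Field F] {p : ℕ} [Fact p.Prime] (k d : ℕ)
    (hd : p = 2 * d + 1) (x : F) :
    ∏ i : Fin k, (x ^ p ^ (i : ℕ)) ^ d = x ^ (p ^ k / 2) := by
  simp_rw [← pow_mul]
  rw [Finset.prod_pow_eq_pow_sum]
  congr 1
  have h := sum_geom_mul_pred (p := p) k
  rw [show p - 1 = 2 * d by omega] at h
  have h2 : ∑ i : Fin k, p ^ (i : ℕ) * (2 * d) = 2 * ∑ i : Fin k, p ^ (i : ℕ) * d := by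
    rw [Finset.mul_sum]
    exact Finset.sum_congr rfl fun i _ => by ring
  have hodd : Odd (p ^ k) := Odd.pow ⟨d, hd⟩
  obtain ⟨t, ht⟩ := hodd
  omega

theorem sum_pow_card_sub_one_field {K : Type*} [Field K] [Fintype K] :
    ∑ y : K, y ^ (Fintype.card K - 1) = -1 := by
  classical
  have h : ∀ y : K, y ^ (Fintype.card K - 1) = 1 - if y = 0 then 1 else 0 := by
    intro y
    split_ifs with hy
    · rw [hy, zero_pow (by have := Fintype.one_lt_card (α := K); omega)]
      simp
    · rw [FiniteField.pow_card_sub_one_eq_one y hy, sub_zero]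
  simp_rw [h]
  simp

/-- A character distinct from three others is not a linear combination of them. -/
theorem eq_zero_of_monoidHom_combination {G F : Type*} [MulOneClass G] [Field F]
    {χ₀ χ₁ χ₂ χ₃ : G →* F} (h1 : χ₀ ≠ χ₁) (h2 : χ₀ ≠ χ₂) (h3 : χ₀ ≠ χ₃) {a x y z : F}
    (h : ∀ g, a * χ₀ g = x * χ₁ g + y * χ₂ g + z * χ₃ g) : a = 0 := by
  by_contra ha
  have hli := linearIndependent_monoidHom G F
  have hmem := hli.notMem_span_image (s := {χ₁, χ₂, χ₃}) (x := χ₀) (by simp [h1, h2, h3])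
  apply hmem
  have : (χ₀ : G → F) = a⁻¹ • (x • ⇑χ₁ + y • ⇑χ₂ + z • ⇑χ₃) := by
    ext g
    simp only [Pi.smul_apply, Pi.add_apply, smul_eq_mul, ← h g]
    field_simp
  rw [this]
  refine Submodule.smul_mem _ _ (Submodule.add_mem _ (Submodule.add_mem _ ?_ ?_) ?_) <;>
    exact Submodule.smul_mem _ _ (Submodule.subset_span ⟨_, by simp, rfl⟩)

/-- If neither `σ` nor `σ ∘ σ` is the identity, then `y ↦ y - α σ(y)` is not a multiple of a
Frobenius power of `y ↦ y - β σ(y)`. -/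
theorem not_sub_mul_eq_mul_pow {K F : Type*} [Field K] [Field F] [Algebra K F] {p : ℕ}
    [Fact p.Prime] [CharP K p] (σ : K →+* K) (hσ : σ ≠ RingHom.id K)
    (hσσ : σ.comp σ ≠ RingHom.id K) {α β γ : F} (hα : α ≠ 0) (hαβ : α ≠ β) {i : ℕ}
    (hi : iterateFrobenius K p i = RingHom.id K → i = 0) :
    ¬ ∀ y, algebraMap K F y - α * algebraMap K F (σ y) =
      γ * (algebraMap K F y - β * algebraMap K F (σ y)) ^ p ^ i := by
  intro h
  have : CharP F p := charP_of_injective_algebraMap (algebraMap K F).injective p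
  let φ : K →+* K := iterateFrobenius K p i
  let hom : (K →+* K) → K →* F := fun τ => ((algebraMap K F).comp τ : K →+* F)
  have hinj : ∀ τ τ' : K →+* K, τ ≠ τ' → hom τ ≠ hom τ' := by
    intro τ τ' hne heq
    exact hne (RingHom.ext fun y => (algebraMap K F).injective (DFunLike.congr_fun heq y))
  have hrel : ∀ y, hom (RingHom.id K) y - α * hom σ y =
      γ * hom φ y - γ * β ^ p ^ i * hom (φ.comp σ) y := by
    intro y
    have := h y
    rw [sub_pow_char_pow, mul_pow, ← map_pow, ← map_pow] at this
    change algebraMap K F y - α * algebraMap K F (σ y) =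
      γ * algebraMap K F (y ^ p ^ i) - γ * β ^ p ^ i * algebraMap K F (σ y ^ p ^ i)
    rw [this]
    ring
  by_cases hφ : φ = RingHom.id K
  · have h0 : ∀ y, (1 - γ) * hom (RingHom.id K) y = (α - γ * β) * hom σ y := by
      intro y
      have := h y
      rw [hi hφ, pow_zero, pow_one] at this
      change (1 - γ) * algebraMap K F y = (α - γ * β) * algebraMap K F (σ y)
      linear_combination this
    have hγ : 1 - γ = 0 :=
      eq_zero_of_monoidHom_combination (hinj _ _ (Ne.symm hσ)) (hinj _ _ (Ne.symm hσ))
        (hinj _ _ (Ne.symm hσ)) (x := α - γ * β) (y := 0) (z := 0) fun y => by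
          linear_combination h0 y
    have hα' : α - γ * β = 0 :=
      eq_zero_of_monoidHom_combination (hinj _ _ hσ) (hinj _ _ hσ) (hinj _ _ hσ)
        (x := 1 - γ) (y := 0) (z := 0) fun y => by linear_combination -h0 y
    exact hαβ (by linear_combination hα' - β * hγ)
  · by_cases hc : RingHom.id K = φ.comp σ
    · rw [← hc] at hrel
      by_cases hσφ : σ = φ
      · exact hσσ (by rw [hc]; exact congrArg (·.comp σ) hσφ)
      · refine hα (eq_zero_of_monoidHom_combination (hinj _ _ hσ) (hinj _ _ hσφ)
          (hinj _ _ hσ) (x := 1 + γ * β ^ p ^ i) (y := -γ) (z := 0) fun y => ?_)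
        linear_combination -hrel y
    · refine one_ne_zero (eq_zero_of_monoidHom_combination (hinj _ _ (Ne.symm hσ))
        (hinj _ _ (Ne.symm hφ)) (hinj _ _ hc) (x := α) (y := γ) (z := -(γ * β ^ p ^ i))
        fun y => ?_)
      linear_combination hrel y

theorem exists_eq_smul_basis {ι R M : Type*} [Fintype ι] [Nonempty ι] [Field R] [AddCommGroup M]
    [Module R M] (b : Module.Basis ι R M) (x : M)
    (h : ∀ i j, i ≠ j → b.repr x i * b.repr x j = 0) : ∃ i, ∃ c : R, x = c • b i := by
  classical
  obtain ⟨i, hi⟩ : ∃ i, ∀ j, j ≠ i → b.repr x j = 0 := by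
    by_cases hx : ∃ i, b.repr x i ≠ 0
    · obtain ⟨i, hi⟩ := hx
      exact ⟨i, fun j hj => (mul_eq_zero.mp (h i j hj.symm)).resolve_left hi⟩
    · push Not at hx
      exact ⟨Classical.arbitrary ι, fun j _ => hx j⟩
  refine ⟨i, b.repr x i, ?_⟩
  conv_lhs => rw [← b.sum_repr x]
  exact Finset.sum_eq_single i (fun j _ hj => by rw [hi j hj, zero_smul]) (by simp)

section
variable {p : ℕ} [Fact p.Prime] {K F : Type*} [Field K] [Field F]
  [Algebra (ZMod p) K] [Algebra (ZMod p) F]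

/-- The linear map `y ↦ L y ^ p ^ j`. -/
noncomputable def frobComp (L : K →ₗ[ZMod p] F) (j : ℕ) : K →ₗ[ZMod p] F :=
  haveI : CharP F p := charP_of_injective_algebraMap (algebraMap (ZMod p) F).injective p
  AddMonoidHom.toZModLinearMap p ((iterateFrobenius F p j).toAddMonoidHom.comp L.toAddMonoidHom)

theorem frobComp_apply (L : K →ₗ[ZMod p] F) (j : ℕ) (y : K) :
    frobComp L j y = L y ^ p ^ j := rfl

theorem multiset_prod_powers {k : ℕ} (u : Fin k → K →ₗ[ZMod p] F) (e : Fin k → ℕ) (y : K) :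
    ((∑ i, Multiset.replicate (e i) (u i)).map fun L => L y).prod = ∏ i, u i y ^ e i := by
  have := map_sum (Multiset.mapAddMonoidHom fun L : K →ₗ[ZMod p] F => L y)
    (fun i => Multiset.replicate (e i) (u i)) Finset.univ
  rw [Multiset.coe_mapAddMonoidHom] at this
  rw [this, Multiset.prod_sum]
  simp

variable [Fintype K]

/-- A product of fewer than `(p - 1) [K : 𝔽_p]` linear functionals sums to zero
over a finite vector space. -/
theorem sum_prod_linearMap_eq_zero {ι : Type*} [Fintype ι] [DecidableEq ι]
    (L : ι → K →ₗ[ZMod p] F)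
    (h : Fintype.card ι < (p - 1) * Module.finrank (ZMod p) K) :
    ∑ y, ∏ i, L i y = 0 := by
  classical
  let b := Module.finBasis (ZMod p) K
  have key : ∀ f : ι → Fin (Module.finrank (ZMod p) K),
      ∑ x : Fin (Module.finrank (ZMod p) K) → ZMod p, ∏ i, x (f i) = 0 := by
    intro f
    have h1 := MvPolynomial.sum_eval_eq_zero (K := ZMod p)
      (∏ i, (X (f i) : MvPolynomial (Fin (Module.finrank (ZMod p) K)) (ZMod p))) (by
        refine lt_of_le_of_lt (totalDegree_finsetProd _ _) ?_
        simpa [totalDegree_X, ZMod.card] using h)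
    simpa [map_prod] using h1
  rw [← b.equivFun.symm.toEquiv.sum_comp]
  have h2 : ∀ x : Fin (Module.finrank (ZMod p) K) → ZMod p, ∀ i,
      L i (b.equivFun.symm.toEquiv x) = ∑ j, algebraMap (ZMod p) F (x j) * L i (b j) := by
    intro x i
    simp only [LinearEquiv.coe_toEquiv, Module.Basis.equivFun_symm_apply, map_sum, map_smul]
    simp only [Algebra.smul_def]
  simp_rw [h2, Finset.prod_univ_sum, Finset.prod_mul_distrib]
  rw [Finset.sum_comm]
  refine Finset.sum_eq_zero fun f _ => ?_
  rw [← Finset.sum_mul]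
  have := congrArg (algebraMap (ZMod p) F) (key f)
  rw [map_sum, map_zero] at this
  simp_rw [map_prod] at this
  rw [this, zero_mul]

theorem sum_multiset_prod_linearMap_eq_zero (s : Multiset (K →ₗ[ZMod p] F))
    (h : s.card < (p - 1) * Module.finrank (ZMod p) K) :
    ∑ y, (s.map fun L => L y).prod = 0 := by
  induction s using Quotient.inductionOn with
  | h l =>
    have := sum_prod_linearMap_eq_zero (fun i : Fin l.length => l[i]) (by simpa using h)
    rw [← this]
    refine Finset.sum_congr rfl fun y _ => ?_
    simp [← Fin.prod_univ_fun_getElem]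

/-- Among the monomials of degree at most `(p - 1) k` in `k` linear functionals, only the one with
all exponents equal to `p - 1` can have a nonzero sum. -/
theorem sum_monomial_eq_zero {k : ℕ} (hk : Module.finrank (ZMod p) K = k)
    (u : Fin k → K →ₗ[ZMod p] F) (e : Fin k → ℕ) (he : ∑ i, e i ≤ (p - 1) * k)
    (hne : ∃ i, e i ≠ p - 1) : ∑ y, ∏ i, u i y ^ e i = 0 := by
  have hp := (Fact.out : p.Prime).two_le
  by_cases hlt : ∑ i, e i < (p - 1) * k
  · simp_rw [← multiset_prod_powers]
    apply sum_multiset_prod_linearMap_eq_zero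
    simpa [hk] using hlt
  obtain ⟨i, hi⟩ : ∃ i, p ≤ e i := by
    by_contra! hcon
    obtain ⟨i, hi⟩ := hne
    refine hlt ?_
    have : ∑ i, e i < ∑ _i : Fin k, (p - 1) :=
      Finset.sum_lt_sum (fun j _ => by have := hcon j; omega)
        ⟨i, Finset.mem_univ i, by have := hcon i; omega⟩
    simpa [mul_comm] using this
  have h1 : ∀ y, ∏ j, u j y ^ e j =
      ((frobComp (u i) 1 ::ₘ ∑ j, Multiset.replicate (Function.update e i (e i - p) j) (u j)).map
        fun L => L y).prod := by
    intro y
    rw [Multiset.map_cons, Multiset.prod_cons, multiset_prod_powers, frobComp_apply, pow_one,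
      ← Finset.mul_prod_erase _ _ (Finset.mem_univ i),
      ← Finset.mul_prod_erase _ _ (Finset.mem_univ i), ← mul_assoc, Function.update_self,
      ← pow_add, Nat.add_sub_cancel' hi]
    congr 1
    refine Finset.prod_congr rfl fun j hj => ?_
    rw [Function.update_of_ne (Finset.ne_of_mem_erase hj)]
  simp_rw [h1]
  apply sum_multiset_prod_linearMap_eq_zero
  rw [Multiset.card_cons, Multiset.card_sum]
  simp only [Multiset.card_replicate]
  rw [← Finset.add_sum_erase _ _ (Finset.mem_univ i)] at he ⊢
  rw [Function.update_self, hk]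
  have : ∑ j ∈ Finset.univ.erase i, Function.update e i (e i - p) j
      = ∑ j ∈ Finset.univ.erase i, e j :=
    Finset.sum_congr rfl fun j hj => by rw [Function.update_of_ne (Finset.ne_of_mem_erase hj)]
  omega

theorem sum_eval_linearMap {k : ℕ} (hk : Module.finrank (ZMod p) K = k)
    (u : Fin k → K →ₗ[ZMod p] F) (f : MvPolynomial (Fin k) F)
    (hf : f.totalDegree ≤ (p - 1) * k) :
    ∑ y, eval (fun i => u i y) f =
      coeff (Finsupp.equivFunOnFinite.symm fun _ => p - 1) f * ∑ y, ∏ i, u i y ^ (p - 1) := by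
  simp_rw [eval_eq']
  rw [Finset.sum_comm]
  simp_rw [← Finset.mul_sum]
  rw [Finset.sum_eq_single (Finsupp.equivFunOnFinite.symm fun _ => p - 1)]
  · simp
  · intro e he hne
    rw [sum_monomial_eq_zero hk u e, mul_zero]
    · rw [← Finsupp.sum_fintype e (fun _ n => n) (fun _ => rfl)]
      exact (le_totalDegree he).trans hf
    · by_contra! hcon
      exact hne (by ext i; simp [hcon i])
  · intro h
    rw [notMem_support_iff.mp h, zero_mul]

/-- The Frobenius twists of an injective linear map are linearly independent. -/
theorem linearIndependent_frobComp {k : ℕ} (hcard : Fintype.card K = p ^ k)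
    (L : K →ₗ[ZMod p] F) (hL : Function.Injective L) :
    LinearIndependent F fun j : Fin k => frobComp L j := by
  have hp := (Fact.out : p.Prime)
  rw [Fintype.linearIndependent_iff]
  intro g hg i
  let P : Polynomial F := ∑ j : Fin k, Polynomial.C (g j) * Polynomial.X ^ p ^ (j : ℕ)
  have hP : P = 0 := by
    apply Polynomial.eq_zero_of_natDegree_lt_card_of_eval_eq_zero P hL
    · intro y
      have := LinearMap.congr_fun hg y
      simpa [P, Polynomial.eval_finsetSum, frobComp_apply] using this
    · rw [hcard]
      refine lt_of_le_of_lt (Polynomial.natDegree_sum_le_of_forall_le (n := p ^ (k - 1)) _ _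
        fun j _ => ?_) (Nat.pow_lt_pow_right hp.one_lt (by have := i.2; omega))
      exact (Polynomial.natDegree_C_mul_X_pow_le _ _).trans
        (Nat.pow_le_pow_right hp.pos (by have := j.2; omega))
  have h1 := congrArg (Polynomial.coeff · (p ^ (i : ℕ))) hP
  simp only [P, Polynomial.finsetSum_coeff, Polynomial.coeff_C_mul_X_pow,
    Polynomial.coeff_zero] at h1
  rw [Finset.sum_eq_single i] at h1
  · simpa using h1
  · intro j _ hj
    rw [if_neg]
    intro h
    exact hj (Fin.ext (Nat.pow_right_injective hp.two_le h).symm)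
  · simp

theorem sum_prod_basis_pow_ne_zero [Algebra K F] {k : ℕ} (hcard : Fintype.card K = p ^ k)
    (hk : Module.finrank (ZMod p) K = k) (b : Module.Basis (Fin k) F (K →ₗ[ZMod p] F)) :
    ∑ y, ∏ i, b i y ^ (p - 1) ≠ 0 := by
  intro h0
  let ι : K →ₗ[ZMod p] F := AddMonoidHom.toZModLinearMap p (algebraMap K F).toAddMonoidHom
  let f : MvPolynomial (Fin k) F :=
    ∏ j : Fin k, (∑ i, C (b.repr (frobComp ι j) i) * X i) ^ (p - 1)
  have hf : f.totalDegree ≤ (p - 1) * k := by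
    refine (totalDegree_finsetProd _ _).trans ?_
    refine (Finset.sum_le_sum fun j _ => (totalDegree_pow _ _).trans
      (Nat.mul_le_mul_left (p - 1) (?_ : _ ≤ 1))).trans ?_
    · refine totalDegree_finsetSum_le fun i _ => ?_
      exact (totalDegree_mul _ _).trans (by simp)
    · simp [mul_comm]
  have h1 := sum_eval_linearMap hk (fun i => b i) f hf
  rw [h0, mul_zero] at h1
  have h2 : ∀ y : K, eval (fun i => b i y) f = algebraMap K F (y ^ (Fintype.card K - 1)) := by
    intro y
    have h3 : ∀ j : Fin k, ∑ i, b.repr (frobComp ι j) i * b i y =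
        algebraMap K F y ^ p ^ (j : ℕ) := by
      intro j
      have := LinearMap.congr_fun (b.sum_repr (frobComp ι j)) y
      rw [LinearMap.sum_apply] at this
      exact this
    simp only [f, map_prod, map_pow, map_sum, map_mul, eval_C, eval_X, h3]
    simp_rw [← pow_mul]
    rw [Finset.prod_pow_eq_pow_sum, sum_geom_mul_pred, hcard]
  simp_rw [h2] at h1
  rw [← map_sum, sum_pow_card_sub_one_field] at h1
  simp at h1

/-- If a polynomial of degree `d + 1` in a basis of functionals, times the product of the `d`-th
powers of the basis, is a product of few functionals, then its coefficients at exponents bounded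
by `d = (p - 1) / 2` vanish. -/
theorem coeff_eq_zero_of_eval_mul_prod_eq [Algebra K F] {k d : ℕ} (hd : p = 2 * d + 1)
    (hk0 : 0 < k) (hcard : Fintype.card K = p ^ k)
    (hk : Module.finrank (ZMod p) K = k) (b : Module.Basis (Fin k) F (K →ₗ[ZMod p] F))
    (g : MvPolynomial (Fin k) F) (hg : g.totalDegree ≤ d + 1)
    (s : Multiset (K →ₗ[ZMod p] F)) (hs : s.card ≤ 1 + (k - 1) * d) (c : F)
    (h : ∀ y, eval (fun i => b i y) g * ∏ i, b i y ^ d = c * (s.map fun L => L y).prod)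
    (e : Fin k →₀ ℕ) (he : ∀ i, e i ≤ d) (hsum : ∑ i, e i = d + 1) : coeff e g = 0 := by
  have hd0 : 0 < d := by
    have := (Fact.out : p.Prime).two_le
    omega
  have hcompl : ∑ i, (d - e i) + (d + 1) = k * d := by
    rw [← hsum, ← Finset.sum_add_distrib]
    rw [Finset.sum_congr rfl fun i _ => Nat.sub_add_cancel (he i)]
    simp
  let e' : Fin k →₀ ℕ := Finsupp.equivFunOnFinite.symm fun i => 2 * d - e i
  have he' : e'.degree + (d + 1) = k * d + k * d := by
    rw [← hcompl]
    have : e'.degree = ∑ i, (2 * d - e i) := by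
      rw [Finsupp.degree_eq_sum]
      rfl
    rw [this, hcompl, ← hsum, ← Finset.sum_add_distrib,
      Finset.sum_congr rfl fun i _ => Nat.sub_add_cancel ((he i).trans (by omega))]
    simp
    ring
  have h1 := sum_eval_linearMap hk (fun i => b i) (g * monomial e' 1) (by
    refine (totalDegree_mul _ _).trans ?_
    rw [totalDegree_monomial _ one_ne_zero]
    have : (e'.sum fun _ n => n) = e'.degree := rfl
    rw [this]
    have : (p - 1) * k = k * d + k * d := by
      rw [hd, Nat.add_sub_cancel]; ring
    omega)
  have h2 : (Finsupp.equivFunOnFinite.symm fun _ : Fin k => p - 1) = e + e' := by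
    ext i
    have := he i
    simp [e']
    omega
  rw [h2, coeff_mul_monomial, mul_one] at h1
  have h3 : ∀ y : K, eval (fun i => b i y) (g * monomial e' 1)
      = c * ((s + ∑ i, Multiset.replicate (d - e i) (b i)).map fun L => L y).prod := by
    intro y
    rw [Multiset.map_add, Multiset.prod_add, multiset_prod_powers, ← mul_assoc, ← h y, map_mul,
      mul_assoc, ← Finset.prod_mul_distrib, eval_monomial, one_mul,
      Finsupp.prod_fintype _ _ (fun _ => pow_zero _)]
    congr 1
    refine Finset.prod_congr rfl fun i _ => ?_
    rw [← pow_add]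
    have := he i
    congr 1
    simp [e']
    omega
  simp_rw [h3] at h1
  rw [← Finset.mul_sum, sum_multiset_prod_linearMap_eq_zero, mul_zero] at h1
  · exact (mul_eq_zero.mp h1.symm).resolve_right (sum_prod_basis_pow_ne_zero hcard hk b)
  · rw [Multiset.card_add, Multiset.card_sum]
    simp only [Multiset.card_replicate]
    rw [hk, show p - 1 = 2 * d by omega]
    obtain ⟨m, rfl⟩ : ∃ m, k = m + 1 := ⟨k - 1, by omega⟩
    rw [Nat.add_sub_cancel] at hs
    nlinarith

/-- A relation `M L'^((q-1)/2) = -L^((q+1)/2)` with `q = p ^ k` between linear maps constrains the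
coordinates of `L` and `M` in the basis of Frobenius twists of `L'`. -/
theorem coordinates_relation [Algebra K F] {k d : ℕ} (hd : p = 2 * d + 1)
    (hk0 : 0 < k) (hcard : Fintype.card K = p ^ k)
    (hk : Module.finrank (ZMod p) K = k) (b : Module.Basis (Fin k) F (K →ₗ[ZMod p] F))
    (L L' M : K →ₗ[ZMod p] F) (hb : ∀ i, b i = frobComp L' i)
    (h : ∀ y, M y * L' y ^ (p ^ k / 2) = -(L y * L y ^ (p ^ k / 2)))
    {i j : Fin k} (hij : i ≠ j) :
    b.repr L i ^ d * b.repr M j + d * b.repr L i ^ (d - 1) * b.repr L j * b.repr M i = 0 := by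
  have hd0 : 0 < d := by
    have := (Fact.out : p.Prime).two_le
    omega
  let lin : (K →ₗ[ZMod p] F) → MvPolynomial (Fin k) F := fun N => ∑ s, C (b.repr N s) * X s
  have hlin : ∀ N, (lin N).IsHomogeneous 1 := fun N =>
    IsHomogeneous.sum _ _ _ fun s _ => isHomogeneous_C_mul_X _ _
  have heval : ∀ N y, eval (fun s => b s y) (lin N) = N y := by
    intro N y
    have := LinearMap.congr_fun (b.sum_repr N) y
    rw [LinearMap.sum_apply] at this
    simp only [lin, map_sum, map_mul, eval_C, eval_X]
    exact this
  let g := lin L ^ d * lin M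
  have hg : g.IsHomogeneous (d + 1) := by
    have := ((hlin L).pow d).mul (hlin M)
    rwa [one_mul] at this
  obtain ⟨m, rfl⟩ : ∃ m, k = m + 1 := ⟨k - 1, by omega⟩
  have hzero := coeff_eq_zero_of_eval_mul_prod_eq hd hk0 hcard hk b g hg.totalDegree_le
    (frobComp L 1 ::ₘ ∑ s : Fin m, Multiset.replicate d (frobComp L (s + 1))) (by
      rw [Multiset.card_cons, Multiset.card_sum]
      simp [add_comm]) (-1) (by
      intro y
      rw [Multiset.map_cons, Multiset.prod_cons,
        multiset_prod_powers (fun s : Fin m => frobComp L (s + 1)) (fun _ => d)]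
      simp only [hb, frobComp_apply, prod_pow_pow_half _ _ hd, g, map_mul, map_pow]
      simp only [← frobComp_apply, ← hb, heval]
      simp only [frobComp_apply]
      rw [mul_assoc, h y, ← prod_pow_pow_half _ _ hd, Fin.prod_univ_succ]
      simp only [Fin.val_zero, Fin.val_succ, pow_zero, pow_one]
      rw [show (L y) ^ p = L y ^ d * L y * L y ^ d by
        rw [← pow_succ, ← pow_add]
        congr 1
        omega]
      ring)
    (Finsupp.single i d + Finsupp.single j 1)
    (by
      intro s
      by_cases hsi : s = i
      · subst hsi
        simp [hij]
      · rw [Finsupp.add_apply, Finsupp.single_eq_of_ne hsi, zero_add]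
        rw [Finsupp.single_apply]
        split_ifs <;> omega)
    (by simp [Finset.sum_add_distrib])
  have hpair := coeff_aeval_pair g hg hij (a := 1) (by omega)
  rw [Nat.add_sub_cancel, hzero] at hpair
  have hlin' : ∀ N, aeval (fun s => if s = i then 1 else if s = j then Polynomial.X else 0)
      (lin N) = Polynomial.C (b.repr N i) + Polynomial.C (b.repr N j) * Polynomial.X := by
    intro N
    simp only [lin, map_sum, map_mul, aeval_C, aeval_X, Polynomial.algebraMap_eq]
    rw [← Finset.sum_subset (Finset.subset_univ {i, j}), Finset.sum_pair hij]
    · simp [hij.symm]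
    · intro s _ hs
      simp only [Finset.mem_insert, Finset.mem_singleton, not_or] at hs
      simp [hs.1, hs.2]
  simp only [g, map_mul, map_pow, hlin'] at hpair
  have h0 := congrArg (Polynomial.eval 0) (Polynomial.derivative_mul
    (f := (Polynomial.C (b.repr L i) + Polynomial.C (b.repr L j) * Polynomial.X) ^ d)
    (g := Polynomial.C (b.repr M i) + Polynomial.C (b.repr M j) * Polynomial.X))
  rw [← Polynomial.coeff_zero_eq_eval_zero, Polynomial.coeff_derivative, zero_add, hpair] at h0
  simp [Polynomial.derivative_pow] at h0
  rw [h0]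
  ring

theorem finrank_of_card_eq_pow {k : ℕ} (hcard : Fintype.card K = p ^ k) :
    Module.finrank (ZMod p) K = k := by
  have := Module.card_eq_pow_finrank (K := ZMod p) (V := K)
  rw [hcard, ZMod.card] at this
  exact (Nat.pow_right_injective (Fact.out : p.Prime).two_le this).symm

theorem dvd_of_iterateFrobenius_eq_id [CharP K p] {k : ℕ} (hcard : Fintype.card K = p ^ k)
    {i : ℕ} (h : iterateFrobenius K p i = RingHom.id K) : k ∣ i := by
  rw [← finrank_of_card_eq_pow hcard, ← FiniteField.orderOf_frobeniusAlgHom (ZMod p) K]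
  apply orderOf_dvd_of_pow_eq_one
  ext y
  rw [AlgHom.coe_pow, FiniteField.coe_frobeniusAlgHom, ZMod.card, pow_iterate]
  exact DFunLike.congr_fun h y

theorem exists_isSquare_sq_add_mul_add_sq_of_isAlgClosed [CharP K p] [Algebra K F] [IsAlgClosed F]
    (hp2 : p ≠ 2) {k : ℕ} (hk0 : 0 < k) (hcard : Fintype.card K = p ^ k) (σ : K →+* K)
    (hσ : σ ≠ RingHom.id K)
    (hσσ : σ.comp σ ≠ RingHom.id K) {c : K} (hc : c ≠ 2) (hc' : c ≠ -2) :
    ∃ y ≠ 0, IsSquare (y ^ 2 + c * y * σ y + σ y ^ 2) := by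
  by_contra! hcon
  have hp := (Fact.out : p.Prime)
  have hcharF : CharP F p := charP_of_injective_algebraMap (algebraMap (ZMod p) F).injective p
  obtain ⟨d, hd⟩ : ∃ d, p = 2 * d + 1 := hp.odd_of_ne_two hp2
  have hring : ringChar K ≠ 2 := by rwa [ringChar.eq K p]
  have h2 : (2 : F) ≠ 0 := Ring.two_ne_zero (by rwa [ringChar.eq F p])
  have hfin := finrank_of_card_eq_pow hcard
  have hd2 : 2 * (1 + (d : F)) = 1 := by
    have := congrArg (Nat.cast (R := F)) hd
    rw [CharP.cast_eq_zero] at this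
    push_cast at this
    linear_combination -this
  let C := algebraMap K F c
  obtain ⟨δ, hδ⟩ := IsAlgClosed.exists_pow_nat_eq (C ^ 2 - 4) (n := 2) two_pos
  obtain ⟨α, hα⟩ : ∃ α : F, 2 * α = -C + δ := ⟨(-C + δ) / 2, by field_simp⟩
  obtain ⟨β, hβ⟩ : ∃ β : F, 2 * β = -C - δ := ⟨(-C - δ) / 2, by field_simp⟩
  have hsum : α + β = -C := mul_left_cancel₀ h2 (by linear_combination hα + hβ)
  have hprod : α * β = 1 := mul_left_cancel₀ (mul_ne_zero h2 h2) (by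
    linear_combination 2 * β * hα + (-C + δ) * hβ - hδ)
  have hδ0 : δ ≠ 0 := by
    rintro rfl
    have h4 : (c - 2) * (c + 2) = 0 := (algebraMap K F).injective (by
      rw [map_mul, map_sub, map_add, map_ofNat, map_zero]
      linear_combination -hδ)
    rcases mul_eq_zero.mp h4 with h | h
    · exact hc (sub_eq_zero.mp h)
    · exact hc' (eq_neg_of_add_eq_zero_left h)
  have hαβ : α ≠ β := by
    rintro rfl
    exact hδ0 (mul_left_cancel₀ h2 (by linear_combination hβ - hα))
  have hα0 : α ≠ 0 := left_ne_zero_of_mul_eq_one hprod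
  let lin : F → K →ₗ[ZMod p] F := fun a => AddMonoidHom.toZModLinearMap p
    ((algebraMap K F).toAddMonoidHom -
      (AddMonoidHom.mulLeft a).comp ((algebraMap K F).comp σ).toAddMonoidHom)
  have hlin : ∀ a y, lin a y = algebraMap K F y - a * algebraMap K F (σ y) := fun _ _ => rfl
  have hmul : ∀ y, lin α y * lin β y = algebraMap K F (y ^ 2 + c * y * σ y + σ y ^ 2) := by
    intro y
    simp only [hlin, map_add, map_mul, map_pow]
    linear_combination (-algebraMap K F y * algebraMap K F (σ y)) * hsum +
      algebraMap K F (σ y) ^ 2 * hprod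
  have hΔ : ∀ y, y ≠ 0 → y ^ 2 + c * y * σ y + σ y ^ 2 ≠ 0 := fun y hy h =>
    hcon y hy (by rw [h]; exact IsSquare.zero)
  have hinj : Function.Injective (lin β) := by
    rw [injective_iff_map_eq_zero]
    intro y hy
    by_contra hy0
    refine hΔ y hy0 ((algebraMap K F).injective ?_)
    rw [← hmul, hy, mul_zero, map_zero]
  have hhalf : ∀ y, y ≠ 0 → lin α y ^ (p ^ k / 2) * lin β y ^ (p ^ k / 2) = -1 := by
    intro y hy
    rw [← mul_pow, hmul, ← map_pow, ← hcard]
    rcases FiniteField.pow_dichotomy hring (hΔ y hy) with h | h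
    · exact absurd ((FiniteField.isSquare_iff hring (hΔ y hy)).mpr h) (hcon y hy)
    · rw [h, map_neg, map_one]
  have hpow : ∀ y, lin α y ^ p ^ k = lin (α ^ p ^ k) y := by
    intro y
    rw [hlin, hlin, sub_pow_char_pow, mul_pow, ← map_pow, ← map_pow, ← hcard,
      FiniteField.pow_card, FiniteField.pow_card]
  have hrel : ∀ y, lin (α ^ p ^ k) y * lin β y ^ (p ^ k / 2) =
      -(lin α y * lin α y ^ (p ^ k / 2)) := by
    intro y
    rcases eq_or_ne y 0 with rfl | hy
    · simp
    · have hq : p ^ k = p ^ k / 2 + p ^ k / 2 + 1 := by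
        obtain ⟨t, ht⟩ : Odd (p ^ k) := Odd.pow ⟨d, hd⟩
        omega
      rw [← hpow]
      conv_lhs => rw [show lin α y ^ p ^ k = lin α y ^ (p ^ k / 2 + p ^ k / 2 + 1) by rw [← hq]]
      rw [pow_succ, pow_add]
      linear_combination (lin α y ^ (p ^ k / 2) * lin α y) * hhalf y hy
  have : Nonempty (Fin k) := ⟨⟨0, hk0⟩⟩
  have hE : Module.finrank F (K →ₗ[ZMod p] F) = k := by
    rw [Module.finrank_linearMap_self, hfin]
  let b : Module.Basis (Fin k) F (K →ₗ[ZMod p] F) :=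
    basisOfLinearIndependentOfCardEqFinrank (linearIndependent_frobComp hcard (lin β) hinj)
      (by rw [hE, Fintype.card_fin])
  have hb : ∀ i : Fin k, b i = frobComp (lin β) i := fun i => by
    simp [b]
  have hconj : α ^ p ^ k = α ∨ α ^ p ^ k = β := by
    have hroot : α ^ 2 + C * α + 1 = 0 := by linear_combination α * hsum - hprod
    have hfrob := congrArg (iterateFrobenius F p k) hroot
    simp only [map_add, map_mul, map_pow, map_one, map_zero, iterateFrobenius_def] at hfrob
    rw [show C ^ p ^ k = C by rw [← map_pow, ← hcard, FiniteField.pow_card]] at hfrob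
    have : (α ^ p ^ k - α) * (α ^ p ^ k - β) = 0 := by
      linear_combination hfrob - α ^ p ^ k * hsum + hprod
    simpa [sub_eq_zero] using this
  obtain ⟨i, γ, hγ⟩ : ∃ i, ∃ γ : F, lin α = γ • b i := by
    apply exists_eq_smul_basis
    intro i j hij
    by_contra h0
    have hi := left_ne_zero_of_mul h0
    have hj := right_ne_zero_of_mul h0
    rcases hconj with h | h
    · rw [h] at hrel
      have hcoord := coordinates_relation hd hk0 hcard hfin b (lin α) (lin β) (lin α) hb hrel hij
      have hd0 : d ≠ 0 := by
        rintro rfl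
        exact hp.ne_one hd
      have hpred : b.repr (lin α) i ^ d = b.repr (lin α) i ^ (d - 1) * b.repr (lin α) i :=
        (pow_sub_one_mul hd0 _).symm
      rw [hpred] at hcoord
      have : b.repr (lin α) i ^ (d - 1) * (b.repr (lin α) i * b.repr (lin α) j) = 0 := by
        linear_combination 2 * hcoord -
          b.repr (lin α) i ^ (d - 1) * (b.repr (lin α) i * b.repr (lin α) j) * hd2
      exact mul_ne_zero (pow_ne_zero _ hi) h0 this
    · rw [h] at hrel
      have hrepr : ∀ s, b.repr (lin β) s = if s = ⟨0, hk0⟩ then 1 else 0 := by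
        intro s
        have : lin β = b ⟨0, hk0⟩ := by
          ext y
          rw [hb, frobComp_apply, pow_zero, pow_one]
        rw [this, b.repr_self, Finsupp.single_apply]
        simp only [eq_comm]
      have hvanish : ∀ s, s ≠ ⟨0, hk0⟩ → b.repr (lin α) s = 0 := by
        intro s hs
        have hcoord := coordinates_relation hd hk0 hcard hfin b (lin α) (lin β) (lin β) hb hrel hs
        rw [hrepr, hrepr, if_pos rfl, if_neg hs, mul_one, mul_zero, add_zero] at hcoord
        exact eq_zero_of_pow_eq_zero hcoord
      by_cases his : i = ⟨0, hk0⟩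
      · exact hj (hvanish j fun hjs => hij (his.trans hjs.symm))
      · exact hi (hvanish i his)
  refine not_sub_mul_eq_mul_pow (p := p) σ hσ hσσ hα0 hαβ (γ := γ) (i := i)
    (fun h => ?_) fun y => ?_
  · exact Nat.eq_zero_of_dvd_of_lt (dvd_of_iterateFrobenius_eq_id hcard h) i.2
  · have := LinearMap.congr_fun hγ y
    rwa [LinearMap.smul_apply, smul_eq_mul, hb, frobComp_apply] at this

end

/-- Over a finite field of odd characteristic with an automorphism `σ` of order greater than two,
the form `y² + c y σ(y) + σ(y)²` with `c ≠ ±2` represents a square at some nonzero `y`. -/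
theorem exists_isSquare_sq_add_mul_add_sq {K : Type*} [Field K] [Fintype K] {p : ℕ}
    [Fact p.Prime] [CharP K p] (hp2 : p ≠ 2) {k : ℕ} (hk0 : 0 < k)
    (hcard : Fintype.card K = p ^ k) (σ : K →+* K) (hσ : σ ≠ RingHom.id K)
    (hσσ : σ.comp σ ≠ RingHom.id K) {c : K} (hc : c ≠ 2) (hc' : c ≠ -2) :
    ∃ y ≠ 0, IsSquare (y ^ 2 + c * y * σ y + σ y ^ 2) := by
  let _ : Algebra (ZMod p) K := ZMod.algebra K p
  exact exists_isSquare_sq_add_mul_add_sq_of_isAlgClosed (F := AlgebraicClosure K)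
    hp2 hk0 hcard σ hσ hσσ hc hc'

end FiniteFieldForms

/-- The polarization of a planar function vanishing at zero has no nontrivial zeros. -/
theorem IsPlanarFn.eq_zero_of_polar_eq_zero {G H : Type*} [AddGroup G] [AddGroup H] {f : G → H}
    (hf : IsPlanarFn f) (h0 : f 0 = 0) {u w : G} (hu : u ≠ 0) (h : f (w + u) - f w = f u) :
    w = 0 :=
  (hf u hu (f u)).unique h (by rw [zero_add, h0, sub_zero])

/-- A planar function of the form `(x, y) ↦ (σ(x) (x - y), σ(y) (x + ε y))` forces `σ(x) + x`
to vanish at zero only, and `y² + c y σ(y) + σ(y)²` with `c = 2 (ε - 1) / (ε + 1)` to be a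
nonsquare at every nonzero `y`. -/
theorem not_isPlanarFn_of_ringHom {K : Type*} [Field K] [Fintype K] {p : ℕ}
    [Fact p.Prime] [CharP K p] (hp2 : p ≠ 2) {k : ℕ} (hk0 : 0 < k)
    (hcard : Fintype.card K = p ^ k) (σ : K →+* K) (hσ : σ ≠ RingHom.id K)
    {ε : K} (hε : ε ≠ 0) (hε1 : ε ≠ -1) {f : K × K → K × K}
    (hf : ∀ z, f z = (σ z.1 * (z.1 - z.2), σ z.2 * (z.1 + ε * z.2))) : ¬ IsPlanarFn f := by
  intro hplanar
  have h2 : (2 : K) ≠ 0 := Ring.two_ne_zero (by rwa [ringChar.eq K p])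
  have hf0 : f 0 = 0 := by simp [hf]
  have hpolar : ∀ a b x y : K, (a, b) ≠ (0 : K × K) → σ x * (a - b) + σ a * (x - y) = 0 →
      σ y * (a + ε * b) + σ b * (x + ε * y) = 0 → x = 0 ∧ y = 0 := by
    intro a b x y hab h1 h2
    refine Prod.mk_eq_zero.mp (hplanar.eq_zero_of_polar_eq_zero hf0 (w := (x, y)) hab ?_)
    simp only [hf, Prod.mk_add_mk, Prod.mk_sub_mk, map_add, Prod.mk.injEq]
    exact ⟨by linear_combination h1, by linear_combination h2⟩
  have hanti : ∀ r, r + σ r = 0 → r = 0 := by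
    intro r hr
    refine (hpolar 1 0 r 0 (by simp) ?_ (by simp)).1
    rw [map_one]
    linear_combination hr
  have hbij : Function.Bijective fun x => x + σ x := by
    refine Finite.injective_iff_bijective.mp ?_
    exact (injective_iff_map_eq_zero (AddMonoidHom.id K + σ.toAddMonoidHom)).mpr hanti
  have hσσ : σ.comp σ ≠ RingHom.id K := by
    intro h
    refine hσ (RingHom.ext fun z => ?_)
    have hz : σ (σ z) = z := DFunLike.congr_fun h z
    refine sub_eq_zero.mp (hanti (σ z - z) ?_)
    rw [map_sub, hz]
    ring
  have hε' : ε + 1 ≠ 0 := fun h => hε1 (eq_neg_of_add_eq_zero_left h)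
  obtain ⟨c, hc⟩ : ∃ c, c * (ε + 1) = 2 * (ε - 1) := ⟨2 * (ε - 1) / (ε + 1), by field_simp⟩
  obtain ⟨y, hy, z, hz⟩ := exists_isSquare_sq_add_mul_add_sq hp2 hk0 hcard σ hσ hσσ
    (c := c)
    (by
      rintro rfl
      exact mul_ne_zero h2 h2 (by linear_combination hc))
    (by
      rintro rfl
      exact mul_ne_zero (mul_ne_zero h2 h2) hε (by linear_combination -hc))
  obtain ⟨x, hx⟩ := hbij.surjective z
  obtain ⟨r, hr⟩ : ∃ r, 2 * r = x + y := ⟨(x + y) / 2, by field_simp⟩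
  obtain ⟨s, hs⟩ : ∃ s, 2 * s = x - y := ⟨(x - y) / 2, by field_simp⟩
  obtain rfl : y = r - s := mul_left_cancel₀ h2 (by linear_combination hs - hr)
  obtain rfl : x = r + s := mul_left_cancel₀ h2 (by linear_combination -hs - hr)
  simp only [map_add, map_sub] at hx hz
  have hG : (σ s + r) * (s + σ r) + ε * ((r + σ r) * (s + σ s)) = 0 := by
    refine mul_left_cancel₀ (mul_ne_zero h2 h2) ?_
    subst hx
    linear_combination (-(ε + 1)) * hz + (r - s) * (σ r - σ s) * hc
  have hden : s + σ r ≠ 0 := by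
    intro h
    rw [h, mul_zero, zero_add] at hG
    rcases mul_eq_zero.mp ((mul_eq_zero.mp hG).resolve_left hε) with h' | h'
    · obtain rfl := hanti r h'
      rw [map_zero, add_zero] at h
      exact hy (by rw [h, sub_zero])
    · obtain rfl := hanti s h'
      rw [zero_add] at h
      exact hy (by rw [(map_eq_zero σ).mp h, sub_zero])
  obtain ⟨t, ht⟩ : ∃ t, t * (s + σ r) = r + σ r := ⟨(r + σ r) / (s + σ r), by field_simp⟩
  have hr0 : r = 0 := by
    refine (hpolar 1 t r (t * s) (by simp) ?_ ?_).1
    · rw [map_one]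
      linear_combination -ht
    · rw [map_mul]
      refine mul_left_cancel₀ hden ?_
      linear_combination σ t * hG + σ t * ε * (s + σ s) * ht
  subst hr0
  rw [map_zero] at hG
  have hs0 : s = 0 := by simpa using hG
  exact hy (by rw [hs0, sub_zero])

theorem stmt16 (p k ℓ : ℕ) (hp : p.Prime) (hodd : Odd p) (hk : 0 < k) (hl : 0 < ℓ)
    (hndvd : ¬ k ∣ ℓ) (q Q : ℕ) (hq : q = p ^ k) (hQ : Q = p ^ ℓ)
    (K : Type) [Field K] [Fintype K] (hK : Fintype.card K = p ^ k)
    (ε : K) (hε : ε ≠ 0) (hε1 : ε ≠ -1)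
    (P3 : K × K → K × K)
    (hP3 : ∀ xy : K × K, P3 xy =
      (xy.1 ^ (Q + 1) - xy.1 ^ Q * xy.2, xy.1 * xy.2 ^ Q + ε * xy.2 ^ (Q + 1))) :
    ¬ IsPlanarFn P3 := by
  have : Fact p.Prime := ⟨hp⟩
  have : CharP K p := charP_of_card_eq_prime_pow hK
  let _ : Algebra (ZMod p) K := ZMod.algebra K p
  refine not_isPlanarFn_of_ringHom (p := p) (by rintro rfl; exact absurd hodd (by decide))
    hk hK (iterateFrobenius K p ℓ)
    (fun h => hndvd (dvd_of_iterateFrobenius_eq_id hK h)) hε hε1 fun z => ?_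
  rw [hP3, hQ]
  simp only [iterateFrobenius_def, Prod.mk.injEq]
  constructor <;> ring
end
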